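/- Let C ⊂ 𝕋² be a smooth curve with nowhere-vanishing curvature. There exist constants c > 0 and λ₀ > 0, depending only on C, such that for every λ ≥ λ₀ and every nonzero real-valued eigenfunction F of the Laplacian on 𝕋² with eigenvalue λ², one has ∫_C |F| ≥ c·‖F‖₂/√(B_λ). -/

import Mathlib

open MeasureTheory Real

noncomputable section

/-- The Euclidean norm of a vector in `ℝ × ℝ`. -/
def e2 (x : ℝ × ℝ) : ℝ := Real.sqrt (x.1 ^ 2 + x.2 ^ 2)

/-- The integer vector `μ` viewed as a vector in `ℝ × ℝ`. -/
def iv (μ : ℤ × ℤ) : ℝ × ℝ := ((μ.1 : ℝ), (μ.2 : ℝ))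

/-- The set of lattice points on the circle of radius `lam`. -/
def Elat (lam : ℝ) : Finset (ℤ × ℤ) := by
  classical
  exact (Finset.Icc (-⌈lam⌉, -⌈lam⌉) (⌈lam⌉, ⌈lam⌉)).filter
    (fun μ => (μ.1 : ℝ) ^ 2 + (μ.2 : ℝ) ^ 2 = lam ^ 2)

/-- `B_lam`: the maximal number of lattice points on the circle of radius `lam`
lying in an arc of length `√lam`. -/
def Bmax (lam : ℝ) : ℕ := by
  classical
  exact sSup {n : ℕ | ∃ x : ℝ × ℝ, e2 x = lam ∧
    n = ((Elat lam).filter fun ξ => e2 (iv ξ - x) ≤ Real.sqrt lam).card}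

/-- The eigenfunction `F(x) = ∑_{μ ∈ E_lam} a_μ e^{i⟨μ,x⟩}` of the Laplacian on the torus
`ℝ²/(2πℤ²)` with eigenvalue `lam²`. -/
def efn (lam : ℝ) (a : ℤ × ℤ → ℂ) (x : ℝ × ℝ) : ℂ :=
  ∑ μ ∈ Elat lam, a μ *
    Complex.exp (Complex.I * Complex.ofReal ((μ.1 : ℝ) * x.1 + (μ.2 : ℝ) * x.2))

/-- The `L²` norm of `F` over the torus, realized as the square `[0,2π]²`. -/
def l2T (F : ℝ × ℝ → ℂ) : ℝ :=
  Real.sqrt (∫ x in (Set.Icc (0:ℝ) (2 * π)) ×ˢ (Set.Icc (0:ℝ) (2 * π)), ‖F x‖ ^ 2)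

/-- The Gaussian integers of norm `n`. -/
def gaussNormSet (n : ℕ) : Set GaussianInt := {z | z.norm = n}

lemma gaussNormSet_finite (n : ℕ) : (gaussNormSet n).Finite := by
  have h : (fun z : GaussianInt => (z.re, z.im)) '' gaussNormSet n ⊆
      Set.Icc ((-n : ℤ), (-n : ℤ)) ((n : ℤ), (n : ℤ)) := by
    rintro _ ⟨z, hz, rfl⟩
    simp only [gaussNormSet, Set.mem_ofPred_eq, Zsqrtd.norm_def] at hz
    simp only [Set.mem_Icc, Prod.mk_le_mk]
    refine ⟨⟨?_, ?_⟩, ?_, ?_⟩ <;> nlinarith [sq_nonneg z.re, sq_nonneg z.im]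
  refine Set.Finite.of_finite_image ((Set.finite_Icc _ _).subset h) ?_
  intro z _ w _ hzw
  simp only [Prod.mk.injEq] at hzw
  exact Zsqrtd.ext hzw.1 hzw.2

lemma exists_prime_dvd_gaussianInt {p : ℕ} (hp : p.Prime) :
    ∃ q : GaussianInt, Prime q ∧ q ∣ (p : GaussianInt) ∧ ∃ d, 0 < d ∧ q.norm = (p : ℤ) ^ d := by
  have hnu : ¬ IsUnit (p : GaussianInt) := by
    rw [Zsqrtd.isUnit_iff_norm_isUnit, Zsqrtd.norm_natCast, Int.isUnit_iff]
    have := hp.two_le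
    rintro (h | h) <;> nlinarith
  have h0 : (p : GaussianInt) ≠ 0 := by exact_mod_cast hp.ne_zero
  obtain ⟨q, hq, hqp⟩ := WfDvdMonoid.exists_irreducible_factor hnu h0
  refine ⟨q, hq.prime, hqp, ?_⟩
  obtain ⟨w, hw⟩ := hqp
  have hn : q.norm.natAbs ∣ p ^ 2 := by
    have : (p : ℤ) ^ 2 = q.norm * w.norm := by
      rw [← Zsqrtd.norm_mul, ← hw, Zsqrtd.norm_natCast]; ring
    have h2 : q.norm ∣ ((p ^ 2 : ℕ) : ℤ) := by push_cast; exact ⟨_, this⟩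
    exact Int.natAbs_dvd_natAbs.mpr h2
  obtain ⟨d, -, hd⟩ := (Nat.dvd_prime_pow hp).mp hn
  refine ⟨d, ?_, ?_⟩
  · rcases Nat.eq_zero_or_pos d with rfl | h
    · exact absurd (Zsqrtd.norm_eq_one_iff.mp (by simpa using hd)) hq.not_isUnit
    · exact h
  · rw [← GaussianInt.abs_natCast_norm, hd]; push_cast; rfl

lemma gaussianInt_factor_prime_pow {p : ℕ} (hp : p.Prime) {q : GaussianInt} (hq : Prime q)
    (hqp : q ∣ (p : GaussianInt)) {d : ℕ} (hd : 0 < d) (hqd : q.norm = (p : ℤ) ^ d)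
    {m : ℕ} (hm : ¬ p ∣ m) (e : ℕ) :
    ∀ z : GaussianInt, z.norm = (p : ℤ) ^ e * m →
      ∃ a b w, z = q ^ a * (star q) ^ b * w ∧ w.norm = (m : ℤ) ∧ d * (a + b) = e := by
  have hp0 : (p : ℤ) ≠ 0 := by exact_mod_cast hp.ne_zero
  induction e using Nat.strong_induction_on with
  | _ e ih =>
  intro z hz
  rcases Nat.eq_zero_or_pos e with rfl | he
  · exact ⟨0, 0, z, by simp, by simpa using hz, by simp⟩
  have hstep : ∀ w : GaussianInt, (p : ℤ) ^ d * w.norm = (p : ℤ) ^ e * m →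
      d ≤ e ∧ w.norm = (p : ℤ) ^ (e - d) * m := by
    intro w hw
    have hde : d ≤ e := by
      by_contra hlt
      push Not at hlt
      obtain ⟨k, rfl⟩ := Nat.exists_eq_add_of_lt hlt
      have : (p : ℤ) ∣ m := by
        refine ⟨(p : ℤ) ^ k * w.norm, ?_⟩
        have h2 : (p : ℤ) ^ e * (m : ℤ) = (p : ℤ) ^ e * (p * ((p : ℤ) ^ k * w.norm)) := by
          rw [← hw]; ring
        exact mul_left_cancel₀ (pow_ne_zero _ hp0) h2
      exact hm (by exact_mod_cast this)
    refine ⟨hde, ?_⟩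
    obtain ⟨k, rfl⟩ := Nat.exists_eq_add_of_le hde
    rw [Nat.add_sub_cancel_left]
    refine mul_left_cancel₀ (pow_ne_zero d hp0) ?_
    rw [hw]; ring
  have hdvd : q ∣ z * star z := by
    rw [← Zsqrtd.norm_eq_mul_conj, hz]
    refine hqp.trans ?_
    obtain ⟨k, rfl⟩ := Nat.exists_eq_add_of_lt he
    exact ⟨(p : GaussianInt) ^ (0 + k) * m, by push_cast; ring⟩
  rcases hq.dvd_or_dvd hdvd with h | h
  · obtain ⟨w, rfl⟩ := h
    rw [Zsqrtd.norm_mul, hqd] at hz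
    obtain ⟨hde, hw⟩ := hstep w hz
    obtain ⟨a, b, v, rfl, hv, hab⟩ := ih (e - d) (by omega) w hw
    exact ⟨a + 1, b, v, by ring, hv, by rw [add_right_comm, mul_add, hab]; omega⟩
  · obtain ⟨w, hw'⟩ := h
    have hz' : z = star q * star w := by
      rw [← star_star z, hw', star_mul, mul_comm]
    subst hz'
    rw [Zsqrtd.norm_mul, Zsqrtd.norm_conj, hqd] at hz
    obtain ⟨hde, hw⟩ := hstep (star w) hz
    obtain ⟨a, b, v, hwv, hv, hab⟩ := ih (e - d) (by omega) (star w) hw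
    exact ⟨a, b + 1, v, by rw [hwv]; ring, hv, by rw [← add_assoc, mul_add, hab]; omega⟩

lemma ncard_gaussNormSet_prime_pow_mul_le {p : ℕ} (hp : p.Prime) {m : ℕ} (hm : ¬ p ∣ m) (e : ℕ) :
    (gaussNormSet (p ^ e * m)).ncard ≤ (e + 1) * (gaussNormSet m).ncard := by
  obtain ⟨q, hq, hqp, d, hd, hqd⟩ := exists_prime_dvd_gaussianInt hp
  have hsub : gaussNormSet (p ^ e * m) ⊆
      (fun x : ℕ × GaussianInt => q ^ x.1 * (star q) ^ (e / d - x.1) * x.2) ''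
        (((Finset.range (e + 1) : Finset ℕ) : Set ℕ) ×ˢ gaussNormSet m) := by
    intro z hz
    obtain ⟨a, b, w, rfl, hw, hab⟩ :=
      gaussianInt_factor_prime_pow hp hq hqp hd hqd hm e z (by simpa [gaussNormSet] using hz)
    have hed : e / d = a + b := by rw [← hab]; exact Nat.mul_div_cancel_left _ hd
    refine ⟨(a, w), ⟨?_, hw⟩, ?_⟩
    · simp only [Finset.coe_range, Set.mem_Iio]
      nlinarith
    · simp [hed]
  have hfin := (Finset.finite_toSet (Finset.range (e + 1))).prod (gaussNormSet_finite m)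
  refine (Set.ncard_le_ncard hsub (hfin.image _)).trans ((Set.ncard_image_le hfin).trans ?_)
  rw [Set.ncard_prod, Set.ncard_coe_finset, Finset.card_range]

lemma exists_add_one_pow_le_mul_two_pow (k : ℕ) :
    ∃ C : ℝ, 1 ≤ C ∧ ∀ e : ℕ, ((e : ℝ) + 1) ^ k ≤ C * 2 ^ e := by
  have h := tendsto_pow_const_div_const_pow_of_one_lt k (r := (2 : ℝ)) (by norm_num)
  obtain ⟨C, hC⟩ := h.bddAbove_range
  refine ⟨max 1 (2 * C), le_max_left _ _, fun e => ?_⟩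
  have h1 := hC ⟨e + 1, rfl⟩
  simp only [Nat.cast_add, Nat.cast_one] at h1
  rw [div_le_iff₀ (by positivity), pow_succ] at h1
  have : 2 * C * 2 ^ e ≤ max 1 (2 * C) * 2 ^ e := by gcongr; exact le_max_right _ _
  linarith

lemma exists_ncard_gaussNormSet_pow_le (k : ℕ) :
    ∃ C : ℝ, 0 < C ∧ ∀ n : ℕ, n ≠ 0 → ((gaussNormSet n).ncard : ℝ) ^ k ≤ C * n := by
  obtain ⟨C, hC1, hC⟩ := exists_add_one_pow_le_mul_two_pow k
  have hC0 : (0 : ℝ) ≤ C := by linarith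
  set r : ℝ := ((gaussNormSet 1).ncard : ℝ) ^ k with hr
  have hr0 : 0 ≤ r := by positivity
  have key : ∀ n : ℕ, n ≠ 0 → ((gaussNormSet n).ncard : ℝ) ^ k ≤
      r * C ^ (n.primeFactors.filter (· < 2 ^ k)).card * n := by
    intro n
    induction n using Nat.recOnPrimePow with
    | zero => simp
    | one => simp [hr]
    | prime_pow_mul a p e hp hpa he ih =>
      intro hne
      have ha : a ≠ 0 := fun h => by simp [h] at hpa
      have h1 : ((gaussNormSet (p ^ e * a)).ncard : ℝ) ≤ ((e : ℝ) + 1) * (gaussNormSet a).ncard := by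
        exact_mod_cast ncard_gaussNormSet_prime_pow_mul_le hp hpa e
      have hpf : (p ^ e * a).primeFactors = insert p a.primeFactors := by
        rw [Nat.primeFactors_mul (pow_ne_zero _ hp.ne_zero) ha,
          Nat.primeFactors_prime_pow he.ne' hp, Finset.insert_eq]
      have hpn : p ∉ a.primeFactors := fun h => hpa (Nat.dvd_of_mem_primeFactors h)
      calc ((gaussNormSet (p ^ e * a)).ncard : ℝ) ^ k
          ≤ (((e : ℝ) + 1) * (gaussNormSet a).ncard) ^ k := by gcongr
        _ = ((e : ℝ) + 1) ^ k * ((gaussNormSet a).ncard : ℝ) ^ k := mul_pow _ _ _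
        _ ≤ ((e : ℝ) + 1) ^ k *
            (r * C ^ (a.primeFactors.filter (· < 2 ^ k)).card * a) := by gcongr; exact ih ha
        _ ≤ r * C ^ ((p ^ e * a).primeFactors.filter (· < 2 ^ k)).card * ((p ^ e * a : ℕ) : ℝ) := by
          rw [hpf, Finset.filter_insert]
          split_ifs with hlt
          · rw [Finset.card_insert_of_notMem (by simp [hpn]), pow_succ]
            have h2 : ((e : ℝ) + 1) ^ k ≤ C * p ^ e := by
              refine (hC e).trans ?_
              gcongr
              exact_mod_cast hp.two_le
            push_cast
            calc _ ≤ (C * p ^ e) * (r * C ^ (a.primeFactors.filter (· < 2 ^ k)).card * a) := by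
                  gcongr
              _ = _ := by ring
          · have h2 : ((e : ℝ) + 1) ^ k ≤ p ^ e := by
              have h3 : (e : ℝ) + 1 ≤ 2 ^ e := by exact_mod_cast e.lt_two_pow_self
              calc ((e : ℝ) + 1) ^ k ≤ (2 ^ e) ^ k := by gcongr
                _ = (2 ^ k) ^ e := by rw [← pow_mul, ← pow_mul, mul_comm]
                _ ≤ (p : ℝ) ^ e := by
                  gcongr
                  exact_mod_cast not_lt.mp hlt
            push_cast
            calc _ ≤ (p ^ e : ℝ) * (r * C ^ (a.primeFactors.filter (· < 2 ^ k)).card * a) := by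
                  gcongr
              _ = _ := by ring
  refine ⟨r * C ^ (2 ^ k) + 1, by positivity, fun n hn => (key n hn).trans ?_⟩
  have hcard : (n.primeFactors.filter (· < 2 ^ k)).card ≤ 2 ^ k := by
    calc _ ≤ (Finset.range (2 ^ k)).card :=
          Finset.card_le_card fun x hx => by simpa using (Finset.mem_filter.mp hx).2
      _ = _ := Finset.card_range _
  gcongr
  calc r * C ^ (n.primeFactors.filter (· < 2 ^ k)).card ≤ r * C ^ (2 ^ k) := by gcongr
    _ ≤ _ := by linarith

lemma norm_integral_exp_le_of_deriv_ne_zero {φ φ' φ'' : ℝ → ℝ} (h1 : ∀ t, HasDerivAt φ (φ' t) t)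
    (h2 : ∀ t, HasDerivAt φ' (φ'' t) t) (hc : Continuous φ'') {a b : ℝ} (hab : a ≤ b)
    (hne : ∀ t ∈ Set.Icc a b, φ' t ≠ 0) :
    ‖∫ t in a..b, Complex.exp (Complex.I * (φ t : ℂ))‖ ≤
      1 / |φ' a| + 1 / |φ' b| + ∫ t in a..b, |φ'' t| / (φ' t) ^ 2 := by
  have hcφ : Continuous φ := continuous_iff_continuousAt.mpr fun t => (h1 t).continuousAt
  have hcφ' : Continuous φ' := continuous_iff_continuousAt.mpr fun t => (h2 t).continuousAt
  have hu : Set.uIcc a b = Set.Icc a b := Set.uIcc_of_le hab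
  set E : ℝ → ℂ := fun t => Complex.exp (Complex.I * (φ t : ℂ)) with hE
  have hcE : Continuous E := by fun_prop
  have hEn : ∀ t, ‖E t‖ = 1 := fun t => by
    simp only [hE]
    rw [mul_comm]; exact Complex.norm_exp_ofReal_mul_I _
  set G : ℝ → ℂ := fun t => E t / (Complex.I * (φ' t : ℂ)) with hG
  set R : ℝ → ℂ := fun t => E t * (φ'' t : ℂ) / (Complex.I * (φ' t : ℂ) ^ 2) with hR
  have hEd : ∀ t, HasDerivAt E (E t * (Complex.I * (φ' t : ℂ))) t := fun t =>
    (((h1 t).ofReal_comp).const_mul Complex.I).cexp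
  have hGd : ∀ t ∈ Set.uIcc a b, HasDerivAt G (E t - R t) t := by
    intro t ht
    have hn : (φ' t : ℂ) ≠ 0 := by exact_mod_cast hne t (hu ▸ ht)
    have hd := (hEd t).div (((h2 t).ofReal_comp).const_mul Complex.I)
      (mul_ne_zero Complex.I_ne_zero hn)
    refine hd.congr_deriv ?_
    simp only [hR]
    field_simp
  have hcR : ContinuousOn R (Set.uIcc a b) := by
    simp only [hR]
    refine ContinuousOn.div (by fun_prop) (by fun_prop) ?_
    intro t ht
    have hn : (φ' t : ℂ) ≠ 0 := by exact_mod_cast hne t (hu ▸ ht)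
    exact mul_ne_zero Complex.I_ne_zero (pow_ne_zero _ hn)
  have hiE : IntervalIntegrable E volume a b := hcE.intervalIntegrable _ _
  have hiR : IntervalIntegrable R volume a b := hcR.intervalIntegrable
  have hftc := intervalIntegral.integral_eq_sub_of_hasDerivAt hGd (hiE.sub hiR)
  rw [intervalIntegral.integral_sub hiE hiR] at hftc
  have hmain : ∫ t in a..b, E t = G b - G a + ∫ t in a..b, R t := by
    rw [← hftc]; ring
  have hGn : ∀ t, ‖G t‖ = 1 / |φ' t| := fun t => by
    simp [hG, hEn]
  have hRn : ∀ t, ‖R t‖ = |φ'' t| / (φ' t) ^ 2 := fun t => by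
    simp [hR, hEn]
  calc ‖∫ t in a..b, E t‖ ≤ ‖G b‖ + ‖G a‖ + ‖∫ t in a..b, R t‖ := by
        rw [hmain]
        exact (norm_add_le _ _).trans (by gcongr; exact norm_sub_le _ _)
    _ ≤ ‖G b‖ + ‖G a‖ + ∫ t in a..b, ‖R t‖ := by
        gcongr
        exact intervalIntegral.norm_integral_le_integral_norm hab
    _ = _ := by simp only [hGn, hRn]; ring

lemma norm_integral_exp_le_of_monotone_deriv {φ φ' φ'' : ℝ → ℝ}
    (h1 : ∀ t, HasDerivAt φ (φ' t) t) (h2 : ∀ t, HasDerivAt φ' (φ'' t) t) (hc : Continuous φ'')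
    {a b m : ℝ} (hab : a ≤ b) (hm : 0 < m) (hφ' : ∀ t ∈ Set.Icc a b, m ≤ |φ' t|)
    (hφ'' : ∀ t ∈ Set.Icc a b, 0 ≤ φ'' t) :
    ‖∫ t in a..b, Complex.exp (Complex.I * (φ t : ℂ))‖ ≤ 4 / m := by
  have hcφ' : Continuous φ' := continuous_iff_continuousAt.mpr fun t => (h2 t).continuousAt
  have hu : Set.uIcc a b = Set.Icc a b := Set.uIcc_of_le hab
  have hne : ∀ t ∈ Set.Icc a b, φ' t ≠ 0 := fun t ht h => by
    have := hφ' t ht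
    rw [h, abs_zero] at this
    linarith
  have hInt : ∫ t in a..b, |φ'' t| / (φ' t) ^ 2 = (φ' a)⁻¹ - (φ' b)⁻¹ := by
    have hd : ∀ t ∈ Set.uIcc a b, HasDerivAt (fun t => -(φ' t)⁻¹) (|φ'' t| / (φ' t) ^ 2) t := by
      intro t ht
      rw [hu] at ht
      have := ((h2 t).inv (hne t ht)).neg
      refine this.congr_deriv ?_
      rw [abs_of_nonneg (hφ'' t ht)]; ring
    have hcont : ContinuousOn (fun t => |φ'' t| / (φ' t) ^ 2) (Set.uIcc a b) := by
      refine ContinuousOn.div (by fun_prop) (by fun_prop) ?_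
      intro t ht
      exact pow_ne_zero _ (hne t (hu ▸ ht))
    rw [intervalIntegral.integral_eq_sub_of_hasDerivAt hd hcont.intervalIntegrable]
    ring
  have hinv : ∀ t ∈ Set.Icc a b, 1 / |φ' t| ≤ 1 / m := fun t ht =>
    one_div_le_one_div_of_le hm (hφ' t ht)
  have ha := hinv a (Set.left_mem_Icc.mpr hab)
  have hb := hinv b (Set.right_mem_Icc.mpr hab)
  have h3 : (φ' a)⁻¹ ≤ 1 / |φ' a| := by rw [one_div, ← abs_inv]; exact le_abs_self _
  have h4 : -(φ' b)⁻¹ ≤ 1 / |φ' b| := by rw [one_div, ← abs_inv]; exact neg_le_abs _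
  have h5 : 4 / m = 4 * (1 / m) := by ring
  have := norm_integral_exp_le_of_deriv_ne_zero h1 h2 hc hab hne
  rw [hInt] at this
  linarith

lemma norm_integral_exp_le_length (φ : ℝ → ℝ) {a b : ℝ} (hab : a ≤ b) :
    ‖∫ t in a..b, Complex.exp (Complex.I * (φ t : ℂ))‖ ≤ b - a := by
  have := intervalIntegral.norm_integral_le_of_norm_le_const (a := a) (b := b) (C := 1)
    (f := fun t => Complex.exp (Complex.I * (φ t : ℂ))) (fun t _ => by
      rw [mul_comm]; exact (Complex.norm_exp_ofReal_mul_I _).le)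
  rwa [one_mul, abs_of_nonneg (by linarith)] at this

/-- Van der Corput's second derivative test, with a point `s` from which the first derivative
grows linearly. -/
lemma norm_integral_exp_le_of_abs_deriv_ge {φ φ' φ'' : ℝ → ℝ}
    (h1 : ∀ t, HasDerivAt φ (φ' t) t) (h2 : ∀ t, HasDerivAt φ' (φ'' t) t) (hc : Continuous φ'')
    {a b s ρ : ℝ} (hs : s ∈ Set.Icc a b) (hρ : 0 < ρ)
    (hφ' : ∀ t ∈ Set.Icc a b, ρ * |t - s| ≤ |φ' t|)
    (hφ'' : ∀ t ∈ Set.Icc a b, 0 ≤ φ'' t) :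
    ‖∫ t in a..b, Complex.exp (Complex.I * (φ t : ℂ))‖ ≤ 10 / √ρ := by
  have hcφ : Continuous φ := continuous_iff_continuousAt.mpr fun t => (h1 t).continuousAt
  set E : ℝ → ℂ := fun t => Complex.exp (Complex.I * (φ t : ℂ)) with hE
  have hcE : Continuous E := by fun_prop
  have hi : ∀ x y, IntervalIntegrable E volume x y := fun x y => hcE.intervalIntegrable _ _
  set δ := 1 / √ρ with hδ
  have hsq : 0 < √ρ := Real.sqrt_pos.mpr hρ
  have hδ0 : 0 < δ := by positivity
  have hρδ : ρ * δ = √ρ := by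
    rw [hδ, mul_one_div, div_eq_iff hsq.ne', Real.mul_self_sqrt hρ.le]
  have h4 : 4 / (ρ * δ) = 4 * δ := by rw [hρδ, hδ]; ring
  have hleft : ‖∫ t in a..s, E t‖ ≤ 5 * δ := by
    rcases le_total (s - a) δ with h | h
    · have := norm_integral_exp_le_length φ hs.1
      linarith
    · have e1 : ‖∫ t in a..(s - δ), E t‖ ≤ 4 / (ρ * δ) := by
        refine norm_integral_exp_le_of_monotone_deriv h1 h2 hc (by linarith) (by positivity) ?_ ?_
        · intro t ht
          refine le_trans ?_ (hφ' t ⟨ht.1, by linarith [ht.2, hs.2]⟩)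
          gcongr
          rw [abs_sub_comm]
          exact le_trans (by linarith [ht.2]) (le_abs_self _)
        · exact fun t ht => hφ'' t ⟨ht.1, by linarith [ht.2, hs.2]⟩
      have e2 : ‖∫ t in (s - δ)..s, E t‖ ≤ δ := by
        have := norm_integral_exp_le_length φ (a := s - δ) (b := s) (by linarith)
        linarith
      rw [← intervalIntegral.integral_add_adjacent_intervals (hi a (s - δ)) (hi _ s)]
      have := norm_add_le (∫ t in a..(s - δ), E t) (∫ t in (s - δ)..s, E t)
      linarith
  have hright : ‖∫ t in s..b, E t‖ ≤ 5 * δ := by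
    rcases le_total (b - s) δ with h | h
    · have := norm_integral_exp_le_length φ hs.2
      linarith
    · have e1 : ‖∫ t in (s + δ)..b, E t‖ ≤ 4 / (ρ * δ) := by
        refine norm_integral_exp_le_of_monotone_deriv h1 h2 hc (by linarith) (by positivity) ?_ ?_
        · intro t ht
          refine le_trans ?_ (hφ' t ⟨by linarith [ht.1, hs.1], ht.2⟩)
          gcongr
          exact le_trans (by linarith [ht.1]) (le_abs_self _)
        · exact fun t ht => hφ'' t ⟨by linarith [ht.1, hs.1], ht.2⟩
      have e2 : ‖∫ t in s..(s + δ), E t‖ ≤ δ := by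
        have := norm_integral_exp_le_length φ (a := s) (b := s + δ) (by linarith)
        linarith
      rw [← intervalIntegral.integral_add_adjacent_intervals (hi s (s + δ)) (hi _ b)]
      have := norm_add_le (∫ t in s..(s + δ), E t) (∫ t in (s + δ)..b, E t)
      linarith
  rw [← intervalIntegral.integral_add_adjacent_intervals (hi a s) (hi s b)]
  have := norm_add_le (∫ t in a..s, E t) (∫ t in s..b, E t)
  have h10 : 10 / √ρ = 10 * δ := by rw [hδ]; ring
  linarith

/-- Van der Corput's second derivative test. -/
lemma norm_integral_exp_le_of_deriv2_ge {φ φ' φ'' : ℝ → ℝ}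
    (h1 : ∀ t, HasDerivAt φ (φ' t) t) (h2 : ∀ t, HasDerivAt φ' (φ'' t) t) (hc : Continuous φ'')
    {a b ρ : ℝ} (hab : a ≤ b) (hρ : 0 < ρ) (hφ'' : ∀ t ∈ Set.Icc a b, ρ ≤ φ'' t) :
    ‖∫ t in a..b, Complex.exp (Complex.I * (φ t : ℂ))‖ ≤ 10 / √ρ := by
  have hcφ' : Continuous φ' := continuous_iff_continuousAt.mpr fun t => (h2 t).continuousAt
  have hmono : ∀ x ∈ Set.Icc a b, ∀ y ∈ Set.Icc a b, x ≤ y → ρ * (y - x) ≤ φ' y - φ' x := by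
    intro x hx y hy hxy
    refine (convex_Icc a b).mul_sub_le_image_sub_of_le_deriv hcφ'.continuousOn
      (fun t _ => (h2 t).differentiableAt.differentiableWithinAt) (fun t ht => ?_) x hx y hy hxy
    rw [(h2 t).deriv]
    exact hφ'' t (interior_subset ht)
  obtain ⟨s, hs, hsl, hsr⟩ : ∃ s ∈ Set.Icc a b, (a < s → φ' s ≤ 0) ∧ (s < b → 0 ≤ φ' s) := by
    rcases le_or_gt 0 (φ' a) with h | h
    · exact ⟨a, Set.left_mem_Icc.mpr hab, fun h' => absurd h' (lt_irrefl _), fun _ => h⟩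
    rcases le_or_gt (φ' b) 0 with h' | h'
    · exact ⟨b, Set.right_mem_Icc.mpr hab, fun _ => h', fun h'' => absurd h'' (lt_irrefl _)⟩
    obtain ⟨s, hs, hs0⟩ := intermediate_value_Icc hab hcφ'.continuousOn ⟨h.le, h'.le⟩
    exact ⟨s, hs, fun _ => hs0.le, fun _ => hs0.ge⟩
  refine norm_integral_exp_le_of_abs_deriv_ge h1 h2 hc hs hρ (fun t ht => ?_)
    (fun t ht => hρ.le.trans (hφ'' t ht))
  rcases lt_trichotomy t s with hlt | rfl | hlt
  · have := hmono t ht s hs hlt.le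
    have h3 := hsl (ht.1.trans_lt hlt)
    rw [abs_sub_comm, abs_of_pos (by linarith)]
    exact le_trans (by linarith) (neg_le_abs _)
  · simp
  · have := hmono s hs t ht hlt.le
    have h3 := hsr (hlt.trans_le ht.2)
    rw [abs_of_pos (by linarith)]
    exact le_trans (by linarith) (le_abs_self _)

lemma hasDerivAt_fst_comp {f : ℝ → ℝ × ℝ} {f' : ℝ × ℝ} {t : ℝ} (h : HasDerivAt f f' t) :
    HasDerivAt (fun t => (f t).1) f'.1 t := by
  simpa using h.hasFDerivAt.fst.hasDerivAt

lemma hasDerivAt_snd_comp {f : ℝ → ℝ × ℝ} {f' : ℝ × ℝ} {t : ℝ} (h : HasDerivAt f f' t) :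
    HasDerivAt (fun t => (f t).2) f'.2 t := by
  simpa using h.hasFDerivAt.snd.hasDerivAt

lemma norm_integral_exp_lt_length {φ φ' : ℝ → ℝ} (h1 : ∀ t, HasDerivAt φ (φ' t) t)
    {a b t₁ : ℝ} (ht₁ : t₁ ∈ Set.Ioo a b) (hne : φ' t₁ ≠ 0) :
    ‖∫ t in a..b, Complex.exp (Complex.I * (φ t : ℂ))‖ < b - a := by
  have hab : a < b := ht₁.1.trans ht₁.2
  have hcφ : Continuous φ := continuous_iff_continuousAt.mpr fun t => (h1 t).continuousAt
  refine lt_of_le_of_ne (norm_integral_exp_le_length φ hab.le) fun heq => hne ?_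
  set E : ℝ → ℂ := fun t => Complex.exp (Complex.I * (φ t : ℂ)) with hE
  have hcE : Continuous E := by fun_prop
  have hEn : ∀ t, ‖E t‖ = 1 := fun t => by
    simp only [hE]
    rw [mul_comm]; exact Complex.norm_exp_ofReal_mul_I _
  set Z : ℂ := ∫ t in a..b, E t with hZ
  have hZ0 : 0 < ‖Z‖ := by rw [heq]; linarith
  set ω : ℂ := (starRingEnd ℂ Z) / (‖Z‖ : ℂ) with hω
  have hωn : ‖ω‖ = 1 := by
    rw [hω, norm_div, RCLike.norm_conj, Complex.norm_real, norm_norm, div_self hZ0.ne']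
  have hωZ : ω * Z = (‖Z‖ : ℂ) := by
    have h0 : (‖Z‖ : ℂ) ≠ 0 := by exact_mod_cast hZ0.ne'
    rw [hω, div_mul_eq_mul_div, mul_comm, Complex.mul_conj, Complex.normSq_eq_norm_sq]
    push_cast
    field_simp
  have hwn : ∀ t, ‖ω * E t‖ = 1 := fun t => by rw [norm_mul, hωn, hEn, one_mul]
  have hre_le : ∀ t, (ω * E t).re ≤ 1 := fun t => (Complex.re_le_norm _).trans (hwn t).le
  have hcre : Continuous fun t => (ω * E t).re := by fun_prop
  have hInt : ∫ t in a..b, (ω * E t).re = ∫ t in a..b, (1 : ℝ) := by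
    have h2 : ∫ t in a..b, (ω * E t).re = (∫ t in a..b, ω * E t).re := by
      have := Complex.reCLM.intervalIntegral_comp_comm (f := fun t => ω * E t)
        ((continuous_const.mul hcE).intervalIntegrable (μ := volume) a b)
      simpa using this
    rw [h2, intervalIntegral.integral_const_mul, ← hZ, hωZ, Complex.ofReal_re, heq]
    simp
  have hone : ∀ t ∈ Set.Icc a b, (ω * E t).re = 1 := by
    by_contra! hcon
    obtain ⟨t, ht, hne1⟩ := hcon
    exact (intervalIntegral.integral_lt_integral_of_continuousOn_of_le_of_exists_lt hab
      hcre.continuousOn continuousOn_const (fun t _ => hre_le t)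
      ⟨t, ht, lt_of_le_of_ne (hre_le t) hne1⟩).ne hInt
  have hconst : ∀ t ∈ Set.Icc a b, ω * E t = 1 := by
    intro t ht
    have hr := hone t ht
    have hn := hwn t
    have hsq : Complex.normSq (ω * E t) = 1 := by rw [Complex.normSq_eq_norm_sq, hn, one_pow]
    rw [Complex.normSq_apply, hr] at hsq
    refine Complex.ext (by simpa using hr) ?_
    have : (ω * E t).im * (ω * E t).im = 0 := by linarith
    simpa using this
  have hEd : HasDerivAt (fun t => ω * E t) (ω * (E t₁ * (Complex.I * (φ' t₁ : ℂ)))) t₁ :=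
    ((((h1 t₁).ofReal_comp).const_mul Complex.I).cexp).const_mul ω
  have hloc : (fun t => ω * E t) =ᶠ[nhds t₁] fun _ => (1 : ℂ) := by
    filter_upwards [Icc_mem_nhds ht₁.1 ht₁.2] with t ht using hconst t ht
  have hz := hEd.unique ((hasDerivAt_const t₁ (1 : ℂ)).congr_of_eventuallyEq hloc)
  rw [← mul_assoc, hconst t₁ ⟨ht₁.1.le, ht₁.2.le⟩, one_mul] at hz
  simpa using hz

lemma abs_mul_add_mul_le_sqrt_mul {x y u v r : ℝ} (hu : |u| ≤ r) (hv : |v| ≤ r) :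
    |x * u + y * v| ≤ 2 * r * √(x ^ 2 + y ^ 2) := by
  have hx : |x| ≤ √(x ^ 2 + y ^ 2) := Real.abs_le_sqrt (by nlinarith [sq_nonneg y])
  have hy : |y| ≤ √(x ^ 2 + y ^ 2) := Real.abs_le_sqrt (by nlinarith [sq_nonneg x])
  have hr : 0 ≤ r := (abs_nonneg u).trans hu
  calc |x * u + y * v| ≤ |x| * |u| + |y| * |v| := by
        rw [← abs_mul, ← abs_mul]; exact abs_add_le _ _
    _ ≤ √(x ^ 2 + y ^ 2) * r + √(x ^ 2 + y ^ 2) * r := by gcongr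
    _ = _ := by ring

/-- A short arc of the curve on which every linear phase is either non-stationary or has a large
second derivative of constant sign. -/
lemma exists_subarc_phase_dichotomy {L K : ℝ} {γ : ℝ → ℝ × ℝ} (hL : 0 < L) (hK : 0 < K)
    (hγ : ContDiff ℝ (⊤ : ℕ∞) γ) (hunit : ∀ t ∈ Set.Icc (0 : ℝ) L, e2 (deriv γ t) = 1)
    (hcurv : ∀ t ∈ Set.Icc (0 : ℝ) L, K ≤ e2 (deriv (deriv γ) t)) :
    ∃ a b c P : ℝ, 0 ≤ a ∧ a < b ∧ b ≤ L ∧ 0 < c ∧ 0 < P ∧ ∀ x y : ℝ,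
      (∀ t ∈ Set.Icc a b, c * √(x ^ 2 + y ^ 2) ≤ |x * (deriv γ t).1 + y * (deriv γ t).2| ∧
        |x * (deriv (deriv γ) t).1 + y * (deriv (deriv γ) t).2| ≤ P * √(x ^ 2 + y ^ 2)) ∨
      (∀ t ∈ Set.Icc a b,
        c * √(x ^ 2 + y ^ 2) ≤ x * (deriv (deriv γ) t).1 + y * (deriv (deriv γ) t).2) ∨
      (∀ t ∈ Set.Icc a b,
        c * √(x ^ 2 + y ^ 2) ≤ (-x) * (deriv (deriv γ) t).1 + (-y) * (deriv (deriv γ) t).2) := by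
  have hd1 : ContDiff ℝ (⊤ : ℕ∞) (deriv γ) := (contDiff_infty_iff_deriv.mp hγ).2
  have hd2 : ContDiff ℝ (⊤ : ℕ∞) (deriv (deriv γ)) := (contDiff_infty_iff_deriv.mp hd1).2
  have hc1 : Continuous (deriv γ) := hd1.continuous
  have hc2 : Continuous (deriv (deriv γ)) := hd2.continuous
  set t₀ := L / 2 with ht₀
  have ht₀m : t₀ ∈ Set.Icc 0 L := ⟨by positivity, by linarith⟩
  set T := deriv γ t₀ with hT
  set N := deriv (deriv γ) t₀ with hN
  have hTn : T.1 ^ 2 + T.2 ^ 2 = 1 := by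
    have := hunit t₀ ht₀m
    rwa [e2, Real.sqrt_eq_one] at this
  have hNn : K ^ 2 ≤ N.1 ^ 2 + N.2 ^ 2 := by
    have := hcurv t₀ ht₀m
    rw [e2] at this
    exact (Real.le_sqrt hK.le (by positivity)).mp this
  have hder : HasDerivAt (deriv γ) N t₀ := (hd1.differentiable (by simp) t₀).hasDerivAt
  have hder1 : HasDerivAt (fun t => (deriv γ t).1) N.1 t₀ :=
    hasDerivAt_fst_comp hder
  have hder2 : HasDerivAt (fun t => (deriv γ t).2) N.2 t₀ :=
    hasDerivAt_snd_comp hder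
  have hTN : T.1 * N.1 + T.2 * N.2 = 0 := by
    have hs := (hder1.pow 2).add (hder2.pow 2)
    have hloc : (fun t => (deriv γ t).1) ^ 2 + (fun t => (deriv γ t).2) ^ 2
        =ᶠ[nhds t₀] fun _ => (1 : ℝ) := by
      filter_upwards [Icc_mem_nhds (show 0 < t₀ by positivity) (show t₀ < L by linarith)] with t ht
      have := hunit t ht
      rwa [e2, Real.sqrt_eq_one] at this
    have := hs.unique ((hasDerivAt_const t₀ (1 : ℝ)).congr_of_eventuallyEq hloc)
    simp only [Nat.cast_ofNat, Nat.add_one_sub_one, pow_one] at this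
    linarith
  have hev : ∀ᶠ t in nhds t₀, |(deriv γ t).1 - T.1| < 1 / 10 ∧ |(deriv γ t).2 - T.2| < 1 / 10 ∧
      |(deriv (deriv γ) t).1 - N.1| < K / 10 ∧ |(deriv (deriv γ) t).2 - N.2| < K / 10 := by
    have key : ∀ (f : ℝ → ℝ) (r : ℝ), Continuous f → 0 < r →
        ∀ᶠ t in nhds t₀, |f t - f t₀| < r := fun f r hf hr => by
      simpa [Real.dist_eq] using Metric.tendsto_nhds.mp (hf.tendsto t₀) r hr
    have e1 := key (fun t => (deriv γ t).1) (1 / 10) (by fun_prop) (by norm_num)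
    have e2 := key (fun t => (deriv γ t).2) (1 / 10) (by fun_prop) (by norm_num)
    have e3 := key (fun t => (deriv (deriv γ) t).1) (K / 10) (by fun_prop) (by positivity)
    have e4 := key (fun t => (deriv (deriv γ) t).2) (K / 10) (by fun_prop) (by positivity)
    filter_upwards [e1, e2, e3, e4] with t h1 h2 h3 h4 using ⟨h1, h2, h3, h4⟩
  obtain ⟨ε, hε, hball⟩ := Metric.eventually_nhds_iff.mp hev
  set η := min (ε / 2) (L / 4) with hη
  have hη0 : 0 < η := by positivity
  have hclose : ∀ t ∈ Set.Icc t₀ (t₀ + η), _ := fun t ht => hball (y := t) (by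
    rw [Real.dist_eq, abs_of_nonneg (by linarith [ht.1])]
    have := min_le_left (ε / 2) (L / 4)
    linarith [ht.2])
  have hP : 0 < |N.1| + |N.2| + K := by positivity
  refine ⟨t₀, t₀ + η, min (3 / 10) (3 * K / 10), 2 * (|N.1| + |N.2| + K), ht₀m.1, by linarith, ?_,
    by positivity, by positivity, fun x y => ?_⟩
  · have := min_le_right (ε / 2) (L / 4)
    linarith
  set R := √(x ^ 2 + y ^ 2) with hR
  have hR0 : 0 ≤ R := Real.sqrt_nonneg _
  have hR2 : R ^ 2 = x ^ 2 + y ^ 2 := Real.sq_sqrt (by positivity)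
  have hcA : min (3 / 10) (3 * K / 10) * R ≤ 3 / 10 * R := by gcongr; exact min_le_left _ _
  have hcB : min (3 / 10) (3 * K / 10) * R ≤ 3 * K / 10 * R := by gcongr; exact min_le_right _ _
  have hN' : ∀ t ∈ Set.Icc t₀ (t₀ + η), |(x * (deriv (deriv γ) t).1 + y * (deriv (deriv γ) t).2) -
      (x * N.1 + y * N.2)| ≤ K / 5 * R := fun t ht => by
    obtain ⟨-, -, h3, h4⟩ := hclose t ht
    have := abs_mul_add_mul_le_sqrt_mul (x := x) (y := y) h3.le h4.le
    calc _ = |x * ((deriv (deriv γ) t).1 - N.1) + y * ((deriv (deriv γ) t).2 - N.2)| := by ring_nf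
      _ ≤ _ := this
      _ = _ := by ring
  rcases le_or_gt (R / 2) |x * T.1 + y * T.2| with hA | hB
  · left
    intro t ht
    obtain ⟨h1, h2, h3, h4⟩ := hclose t ht
    constructor
    · have h5 := abs_mul_add_mul_le_sqrt_mul (x := x) (y := y) h1.le h2.le
      have h6 := abs_sub_abs_le_abs_sub (x * T.1 + y * T.2)
        (x * (deriv γ t).1 + y * (deriv γ t).2)
      have h7 : |x * T.1 + y * T.2 - (x * (deriv γ t).1 + y * (deriv γ t).2)| =
          |x * ((deriv γ t).1 - T.1) + y * ((deriv γ t).2 - T.2)| := by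
        rw [abs_sub_comm]; ring_nf
      linarith
    · refine abs_mul_add_mul_le_sqrt_mul ?_ ?_
      · have := abs_sub_abs_le_abs_sub (deriv (deriv γ) t).1 N.1
        have := abs_nonneg N.2
        linarith
      · have := abs_sub_abs_le_abs_sub (deriv (deriv γ) t).2 N.2
        have := abs_nonneg N.1
        linarith
  · right
    have hid : (x * N.1 + y * N.2) ^ 2 =
        (N.1 ^ 2 + N.2 ^ 2) * (R ^ 2 - (x * T.1 + y * T.2) ^ 2) := by
      have e1 : N.1 = -T.2 * (T.1 * N.2 - T.2 * N.1) := by linear_combination (-N.1) * hTn + T.1 * hTN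
      have e2 : N.2 = T.1 * (T.1 * N.2 - T.2 * N.1) := by linear_combination (-N.2) * hTn + T.2 * hTN
      set w := T.1 * N.2 - T.2 * N.1
      have hw : N.1 ^ 2 + N.2 ^ 2 = w ^ 2 := by
        rw [e1, e2]; linear_combination w ^ 2 * hTn
      rw [hw, hR2, e1, e2]
      linear_combination (w ^ 2 * (x ^ 2 + y ^ 2)) * hTn
    have hTs : (x * T.1 + y * T.2) ^ 2 ≤ (R / 2) ^ 2 := by
      rw [← sq_abs]; gcongr
    have hlow : K / 2 * R ≤ |x * N.1 + y * N.2| := by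
      refine abs_le_of_sq_le_sq' ?_ (abs_nonneg _) |>.2
      rw [sq_abs, hid]
      nlinarith [sq_nonneg (K * R), mul_nonneg (sub_nonneg.mpr hNn) (sq_nonneg R),
        mul_nonneg (add_nonneg (sq_nonneg N.1) (sq_nonneg N.2)) (sub_nonneg.mpr hTs)]
    rcases le_total 0 (x * N.1 + y * N.2) with hs | hs
    · left
      intro t ht
      rw [abs_of_nonneg hs] at hlow
      have := (abs_le.mp (hN' t ht)).1
      nlinarith
    · right
      intro t ht
      rw [abs_of_nonpos hs] at hlow
      have := (abs_le.mp (hN' t ht)).2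
      nlinarith

/-- The lattice vector `p` as a complex number. -/
def latC (p : ℤ × ℤ) : ℂ := ⟨p.1, p.2⟩

/-- The Fourier transform of arc length on the arc `γ([a,b])`, at lattice points. -/
def curveHat (γ : ℝ → ℝ × ℝ) (a b : ℝ) (ξ : ℤ × ℤ) : ℂ :=
  ∫ t in a..b, Complex.exp
    (Complex.I * Complex.ofReal ((ξ.1 : ℝ) * (γ t).1 + (ξ.2 : ℝ) * (γ t).2))

lemma norm_latC (p : ℤ × ℤ) : ‖latC p‖ = √((p.1 : ℝ) ^ 2 + (p.2 : ℝ) ^ 2) := by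
  rw [Complex.norm_def, Complex.normSq_mk, latC, ← sq, ← sq]

lemma norm_latC_sq (p : ℤ × ℤ) : ‖latC p‖ ^ 2 = (p.1 : ℝ) ^ 2 + (p.2 : ℝ) ^ 2 := by
  rw [norm_latC, Real.sq_sqrt (by positivity)]

lemma one_le_norm_latC {p : ℤ × ℤ} (hp : p ≠ 0) : 1 ≤ ‖latC p‖ := by
  rw [norm_latC, Real.one_le_sqrt]
  have h : 1 ≤ p.1 ^ 2 + p.2 ^ 2 := by
    by_contra! h
    refine hp (Prod.ext ?_ ?_)
    · show p.1 = 0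
      nlinarith [sq_nonneg p.1, sq_nonneg p.2]
    · show p.2 = 0
      nlinarith [sq_nonneg p.1, sq_nonneg p.2]
  exact_mod_cast h

lemma curveHat_zero (γ : ℝ → ℝ × ℝ) (a b : ℝ) : curveHat γ a b 0 = (b - a : ℝ) := by
  simp [curveHat]

lemma norm_curveHat_neg (γ : ℝ → ℝ × ℝ) (a b : ℝ) (ξ : ℤ × ℤ) :
    ‖curveHat γ a b (-ξ)‖ = ‖curveHat γ a b ξ‖ := by
  rw [← RCLike.norm_conj (curveHat γ a b ξ)]
  congr 1
  simp only [curveHat]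
  rw [← intervalIntegral.intervalIntegral_conj]
  congr 1
  ext t
  rw [← Complex.exp_conj, map_mul, Complex.conj_I, Complex.conj_ofReal]
  congr 1
  push_cast [Prod.fst_neg, Prod.snd_neg]
  ring

lemma norm_curveHat_le_length (γ : ℝ → ℝ × ℝ) {a b : ℝ} (hab : a ≤ b) (ξ : ℤ × ℤ) :
    ‖curveHat γ a b ξ‖ ≤ b - a :=
  norm_integral_exp_le_length _ hab

lemma exists_subarc_curveHat_decay {L K : ℝ} {γ : ℝ → ℝ × ℝ} (hL : 0 < L) (hK : 0 < K)
    (hγ : ContDiff ℝ (⊤ : ℕ∞) γ) (hunit : ∀ t ∈ Set.Icc (0 : ℝ) L, e2 (deriv γ t) = 1)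
    (hcurv : ∀ t ∈ Set.Icc (0 : ℝ) L, K ≤ e2 (deriv (deriv γ) t)) :
    ∃ a b C : ℝ, 0 ≤ a ∧ a < b ∧ b ≤ L ∧ 0 < C ∧ ∀ ξ : ℤ × ℤ, ξ ≠ 0 →
      ‖curveHat γ a b ξ‖ ≤ C / √‖latC ξ‖ ∧ ‖curveHat γ a b ξ‖ < b - a := by
  obtain ⟨a, b, c, P, ha, hab, hb, hc, hP, hdich⟩ :=
    exists_subarc_phase_dichotomy hL hK hγ hunit hcurv
  have hd1 : ContDiff ℝ (⊤ : ℕ∞) (deriv γ) := (contDiff_infty_iff_deriv.mp hγ).2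
  have hd2 : ContDiff ℝ (⊤ : ℕ∞) (deriv (deriv γ)) := (contDiff_infty_iff_deriv.mp hd1).2
  have hc2 : Continuous (deriv (deriv γ)) := hd2.continuous
  have hder : ∀ t, HasDerivAt γ (deriv γ t) t := fun t =>
    (hγ.differentiable (by simp) t).hasDerivAt
  have hder' : ∀ t, HasDerivAt (deriv γ) (deriv (deriv γ) t) t := fun t =>
    (hd1.differentiable (by simp) t).hasDerivAt
  have hφ : ∀ (x y : ℝ) (t : ℝ), HasDerivAt (fun t => x * (γ t).1 + y * (γ t).2)
      (x * (deriv γ t).1 + y * (deriv γ t).2) t := fun x y t =>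
    ((hasDerivAt_fst_comp (hder t)).const_mul x).add ((hasDerivAt_snd_comp (hder t)).const_mul y)
  have hφ' : ∀ (x y : ℝ) (t : ℝ), HasDerivAt (fun t => x * (deriv γ t).1 + y * (deriv γ t).2)
      (x * (deriv (deriv γ) t).1 + y * (deriv (deriv γ) t).2) t := fun x y t =>
    ((hasDerivAt_fst_comp (hder' t)).const_mul x).add ((hasDerivAt_snd_comp (hder' t)).const_mul y)
  have hcont : ∀ x y : ℝ, Continuous fun t =>
      x * (deriv (deriv γ) t).1 + y * (deriv (deriv γ) t).2 := fun x y => by fun_prop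
  set C : ℝ := (2 / c + (b - a) * P / c ^ 2) + 10 / √c with hC
  have hba : 0 < b - a := by linarith
  have hmid : (a + b) / 2 ∈ Set.Ioo a b := ⟨by linarith, by linarith⟩
  refine ⟨a, b, C, ha, hab, hb, by positivity, ?_⟩
  -- the case of a large positive second derivative
  have hpos : ∀ ξ : ℤ × ℤ, ξ ≠ 0 → (∀ t ∈ Set.Icc a b, c * √((ξ.1 : ℝ) ^ 2 + (ξ.2 : ℝ) ^ 2) ≤
      ξ.1 * (deriv (deriv γ) t).1 + ξ.2 * (deriv (deriv γ) t).2) →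
      ‖curveHat γ a b ξ‖ ≤ C / √‖latC ξ‖ ∧ ‖curveHat γ a b ξ‖ < b - a := by
    intro ξ hξ h
    have hR := one_le_norm_latC hξ
    rw [← norm_latC] at h
    have hcR : 0 < c * ‖latC ξ‖ := by positivity
    constructor
    · have := norm_integral_exp_le_of_deriv2_ge (hφ ξ.1 ξ.2) (hφ' ξ.1 ξ.2) (hcont _ _) hab.le hcR h
      refine le_trans this ?_
      rw [Real.sqrt_mul hc.le, ← div_div]
      gcongr
      rw [hC]
      have : 0 < 2 / c + (b - a) * P / c ^ 2 := by positivity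
      linarith
    · by_contra hcon
      have hz : ∀ t ∈ Set.Ioo a b, ξ.1 * (deriv γ t).1 + ξ.2 * (deriv γ t).2 = 0 := by
        intro t ht
        by_contra hne
        exact hcon (norm_integral_exp_lt_length (hφ ξ.1 ξ.2) ht hne)
      have hloc : (fun t => ξ.1 * (deriv γ t).1 + ξ.2 * (deriv γ t).2)
          =ᶠ[nhds ((a + b) / 2)] fun _ => (0 : ℝ) := by
        filter_upwards [Ioo_mem_nhds hmid.1 hmid.2] with t ht using hz t ht
      have h0 := (hφ' ξ.1 ξ.2 ((a + b) / 2)).unique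
        ((hasDerivAt_const _ (0 : ℝ)).congr_of_eventuallyEq hloc)
      have := h _ (Set.Ioo_subset_Icc_self hmid)
      linarith
  intro ξ hξ
  rcases hdich ξ.1 ξ.2 with h | h | h
  · have hR := one_le_norm_latC hξ
    rw [← norm_latC] at h
    have hcR : 0 < c * ‖latC ξ‖ := by positivity
    have hne : ∀ t ∈ Set.Icc a b, ξ.1 * (deriv γ t).1 + ξ.2 * (deriv γ t).2 ≠ 0 := fun t ht h0 => by
      have := (h t ht).1
      rw [h0, abs_zero] at this
      linarith
    refine ⟨?_, norm_integral_exp_lt_length (hφ ξ.1 ξ.2) hmid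
      (hne _ (Set.Ioo_subset_Icc_self hmid))⟩
    have hmain := norm_integral_exp_le_of_deriv_ne_zero (hφ ξ.1 ξ.2) (hφ' ξ.1 ξ.2) (hcont _ _)
      hab.le hne
    have hA := one_div_le_one_div_of_le hcR (h a (Set.left_mem_Icc.mpr hab.le)).1
    have hB := one_div_le_one_div_of_le hcR (h b (Set.right_mem_Icc.mpr hab.le)).1
    have hI : ∫ t in a..b, |ξ.1 * (deriv (deriv γ) t).1 + ξ.2 * (deriv (deriv γ) t).2| /
        (ξ.1 * (deriv γ t).1 + ξ.2 * (deriv γ t).2) ^ 2 ≤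
        (b - a) * (P * ‖latC ξ‖ / (c * ‖latC ξ‖) ^ 2) := by
      have := intervalIntegral.norm_integral_le_of_norm_le_const (a := a) (b := b)
        (C := P * ‖latC ξ‖ / (c * ‖latC ξ‖) ^ 2)
        (f := fun t => |ξ.1 * (deriv (deriv γ) t).1 + ξ.2 * (deriv (deriv γ) t).2| /
          (ξ.1 * (deriv γ t).1 + ξ.2 * (deriv γ t).2) ^ 2) (fun t ht => by
          rw [Set.uIoc_of_le hab.le] at ht
          obtain ⟨h1, h2⟩ := h t ⟨ht.1.le, ht.2⟩
          rw [norm_div, norm_pow, Real.norm_eq_abs, Real.norm_eq_abs, abs_abs]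
          gcongr)
      rw [abs_of_pos hba, mul_comm] at this
      exact (le_abs_self _).trans this
    have hs : √‖latC ξ‖ ≤ ‖latC ξ‖ := by
      rw [Real.sqrt_le_left (by positivity)]
      nlinarith
    calc ‖curveHat γ a b ξ‖
        ≤ 1 / (c * ‖latC ξ‖) + 1 / (c * ‖latC ξ‖) +
          (b - a) * (P * ‖latC ξ‖ / (c * ‖latC ξ‖) ^ 2) := by
          refine le_trans hmain ?_
          linarith
      _ = (2 / c + (b - a) * P / c ^ 2) / ‖latC ξ‖ := by
          field_simp
          ring
      _ ≤ C / ‖latC ξ‖ := by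
          gcongr
          rw [hC]
          have : 0 < 10 / √c := by positivity
          linarith
      _ ≤ C / √‖latC ξ‖ := by gcongr
  · exact hpos ξ hξ h
  · have hneg : ‖latC (-ξ)‖ = ‖latC ξ‖ := by simp [norm_latC]
    have := hpos (-ξ) (neg_ne_zero.mpr hξ) (by simpa using h)
    rwa [norm_curveHat_neg, hneg] at this

/-- A short arc on which the Fourier transform of arc length decays and is uniformly smaller than
its value at the origin. -/
lemma exists_subarc_curveHat_bounds {L K : ℝ} {γ : ℝ → ℝ × ℝ} (hL : 0 < L) (hK : 0 < K)
    (hγ : ContDiff ℝ (⊤ : ℕ∞) γ) (hunit : ∀ t ∈ Set.Icc (0 : ℝ) L, e2 (deriv γ t) = 1)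
    (hcurv : ∀ t ∈ Set.Icc (0 : ℝ) L, K ≤ e2 (deriv (deriv γ) t)) :
    ∃ a b C δ : ℝ, 0 ≤ a ∧ a < b ∧ b ≤ L ∧ 0 < C ∧ 0 < δ ∧ ∀ ξ : ℤ × ℤ, ξ ≠ 0 →
      ‖curveHat γ a b ξ‖ ≤ C / √‖latC ξ‖ ∧ ‖curveHat γ a b ξ‖ ≤ b - a - δ := by
  obtain ⟨a, b, C, ha, hab, hb, hC, h⟩ := exists_subarc_curveHat_decay hL hK hγ hunit hcurv
  have hba : 0 < b - a := by linarith
  set R : ℝ := (2 * C / (b - a)) ^ 2 with hR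
  set S : Finset (ℤ × ℤ) :=
    (Finset.Icc (-⌈R⌉, -⌈R⌉) (⌈R⌉, ⌈R⌉)).filter (· ≠ 0) with hS
  have hmin : ∃ δ > 0, ∀ ξ ∈ S, ‖curveHat γ a b ξ‖ ≤ b - a - δ := by
    rcases S.eq_empty_or_nonempty with h0 | h0
    · exact ⟨1, one_pos, by simp [h0]⟩
    · obtain ⟨ξ₀, hξ₀, hm⟩ := S.exists_max_image (fun ξ => ‖curveHat γ a b ξ‖) h0
      refine ⟨b - a - ‖curveHat γ a b ξ₀‖, ?_, fun ξ hξ => by linarith [hm ξ hξ]⟩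
      linarith [(h ξ₀ (Finset.mem_filter.mp hξ₀).2).2]
  obtain ⟨δ, hδ, hδS⟩ := hmin
  refine ⟨a, b, C, min δ ((b - a) / 2), ha, hab, hb, hC, by positivity, fun ξ hξ =>
    ⟨(h ξ hξ).1, ?_⟩⟩
  rcases le_or_gt ‖latC ξ‖ R with hle | hgt
  · have hmem : ξ ∈ S := by
      have h1 : |(ξ.1 : ℝ)| ≤ ⌈R⌉ :=
        ((Complex.abs_re_le_norm (latC ξ)).trans hle).trans (Int.le_ceil R)
      have h2 : |(ξ.2 : ℝ)| ≤ ⌈R⌉ :=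
        ((Complex.abs_im_le_norm (latC ξ)).trans hle).trans (Int.le_ceil R)
      rw [abs_le] at h1 h2
      simp only [hS, Finset.mem_filter, Finset.mem_Icc, Prod.le_def]
      refine ⟨⟨⟨?_, ?_⟩, ?_, ?_⟩, hξ⟩
      · exact_mod_cast h1.1
      · exact_mod_cast h2.1
      · exact_mod_cast h1.2
      · exact_mod_cast h2.2
    have := hδS ξ hmem
    have := min_le_left δ ((b - a) / 2)
    linarith
  · have h1 := (h ξ hξ).1
    have h2 : C / √‖latC ξ‖ ≤ (b - a) / 2 := by
      have h3 : 2 * C / (b - a) ≤ √‖latC ξ‖ := Real.le_sqrt_of_sq_le hgt.le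
      have h4 : 0 < √‖latC ξ‖ := lt_of_lt_of_le (by positivity) h3
      rw [div_le_iff₀ hba] at h3
      rw [div_le_iff₀ h4]
      linarith
    have := min_le_right δ ((b - a) / 2)
    linarith

lemma latC_add (p q : ℤ × ℤ) : latC (p + q) = latC p + latC q := by
  apply Complex.ext <;> simp [latC]

lemma latC_sub (p q : ℤ × ℤ) : latC (p - q) = latC p - latC q := by
  apply Complex.ext <;> simp [latC]

lemma latC_neg (p : ℤ × ℤ) : latC (-p) = -latC p := by
  apply Complex.ext <;> simp [latC]

lemma e2_eq_norm (x : ℝ × ℝ) : e2 x = ‖(⟨x.1, x.2⟩ : ℂ)‖ := by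
  rw [e2, Complex.norm_def, Complex.normSq_mk, ← sq, ← sq]

lemma e2_iv_sub_iv (p q : ℤ × ℤ) : e2 (iv p - iv q) = ‖latC p - latC q‖ := by
  rw [e2_eq_norm, ← latC_sub]
  simp [latC, iv]

lemma mem_Elat {lam : ℝ} (hlam : 0 ≤ lam) {p : ℤ × ℤ} : p ∈ Elat lam ↔ ‖latC p‖ = lam := by
  have key : (p.1 : ℝ) ^ 2 + (p.2 : ℝ) ^ 2 = lam ^ 2 ↔ ‖latC p‖ = lam := by
    rw [← norm_latC_sq, sq_eq_sq₀ (norm_nonneg _) hlam]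
  simp only [Elat, Finset.mem_filter, key, and_iff_right_iff_imp]
  intro h
  have h1 : |(p.1 : ℝ)| ≤ ⌈lam⌉ :=
    ((Complex.abs_re_le_norm (latC p)).trans h.le).trans (Int.le_ceil lam)
  have h2 : |(p.2 : ℝ)| ≤ ⌈lam⌉ :=
    ((Complex.abs_im_le_norm (latC p)).trans h.le).trans (Int.le_ceil lam)
  rw [abs_le] at h1 h2
  simp only [Finset.mem_Icc, Prod.le_def]
  refine ⟨⟨?_, ?_⟩, ?_, ?_⟩
  · exact_mod_cast h1.1
  · exact_mod_cast h2.1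
  · exact_mod_cast h1.2
  · exact_mod_cast h2.2

lemma neg_mem_Elat {lam : ℝ} (hlam : 0 ≤ lam) {p : ℤ × ℤ} (hp : p ∈ Elat lam) :
    -p ∈ Elat lam := by
  rw [mem_Elat hlam] at hp ⊢
  rw [latC_neg, norm_neg, hp]

/-- The number of lattice points on a circle is bounded by any power of the radius. -/
lemma exists_card_Elat_sq_le :
    ∃ C : ℝ, 0 < C ∧ ∀ m : ℝ, 1 ≤ m → ((Elat (m ^ 8)).card : ℝ) ^ 2 ≤ C * m := by
  obtain ⟨C, hC, h⟩ := exists_ncard_gaussNormSet_pow_le 32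
  refine ⟨C + 1, by positivity, fun m hm => ?_⟩
  rcases (Elat (m ^ 8)).eq_empty_or_nonempty with h0 | ⟨p, hp⟩
  · rw [h0]
    simp only [Finset.card_empty, Nat.cast_zero, ne_eq, OfNat.ofNat_ne_zero, not_false_eq_true,
      zero_pow]
    positivity
  have hm0 : 0 ≤ m ^ 8 := by positivity
  set n : ℕ := (p.1 ^ 2 + p.2 ^ 2).toNat with hn
  have hnZ : (n : ℤ) = p.1 ^ 2 + p.2 ^ 2 := Int.toNat_of_nonneg (by positivity)
  have hnm : (n : ℝ) = m ^ 16 := by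
    have h1 : ((n : ℤ) : ℝ) = (p.1 : ℝ) ^ 2 + (p.2 : ℝ) ^ 2 := by
      rw [hnZ]; push_cast; ring
    rw [← norm_latC_sq, (mem_Elat hm0).mp hp] at h1
    rw [← Int.cast_natCast, h1]
    ring
  have hn0 : n ≠ 0 := by
    intro h0
    rw [h0, Nat.cast_zero] at hnm
    have : 0 < m ^ 16 := by positivity
    linarith
  have hcard : (Elat (m ^ 8)).card ≤ (gaussNormSet n).ncard := by
    rw [← Set.ncard_coe_finset]
    refine Set.ncard_le_ncard_of_injOn (fun q => (⟨q.1, q.2⟩ : GaussianInt)) ?_ ?_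
      (gaussNormSet_finite n)
    · intro q hq
      have hq' := (mem_Elat hm0).mp (Finset.mem_coe.mp hq)
      have h1 : (q.1 : ℝ) ^ 2 + (q.2 : ℝ) ^ 2 = n := by
        rw [← norm_latC_sq, hq', hnm]; ring
      have h2 : q.1 ^ 2 + q.2 ^ 2 = (n : ℤ) := by exact_mod_cast h1
      show Zsqrtd.norm _ = _
      rw [Zsqrtd.norm_def, ← h2]
      ring
    · intro q _ r _ hqr
      have := Zsqrtd.ext_iff.mp hqr
      exact Prod.ext this.1 this.2
  have h1 : ((Elat (m ^ 8)).card : ℝ) ^ 32 ≤ C * m ^ 16 := by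
    rw [← hnm]
    refine le_trans ?_ (h n hn0)
    gcongr
  have h2 : (((Elat (m ^ 8)).card : ℝ) ^ 2) ^ 16 ≤ ((C + 1) * m) ^ 16 := by
    rw [← pow_mul, mul_pow]
    refine h1.trans ?_
    gcongr
    calc C ≤ C + 1 := by linarith
      _ ≤ (C + 1) ^ 16 := le_self_pow₀ (by linarith) (by norm_num)
  exact le_of_pow_le_pow_left₀ (by norm_num) (by positivity) h2

/-- Three distinct lattice points on a circle of radius `lam` cannot be too close together. -/
lemma le_pow_three_of_mem_Elat {lam ρ : ℝ} (hlam : 0 ≤ lam) {p q r : ℤ × ℤ}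
    (hp : p ∈ Elat lam) (hq : q ∈ Elat lam) (hr : r ∈ Elat lam) (hpq : p ≠ q) (hpr : p ≠ r)
    (hqr : q ≠ r) (h1 : ‖latC (q - p)‖ ≤ ρ) (h2 : ‖latC (r - p)‖ ≤ ρ) : lam ≤ ρ ^ 3 := by
  have hρ : 0 ≤ ρ := (norm_nonneg _).trans h1
  have h3 : ‖latC (q - r)‖ ≤ 2 * ρ := by
    have : latC (q - r) = latC (q - p) - latC (r - p) := by
      rw [← latC_sub]; congr 1; abel
    rw [this]
    linarith [norm_sub_le (latC (q - p)) (latC (r - p))]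
  have e1 := norm_latC_sq p
  have e2 := norm_latC_sq q
  have e3 := norm_latC_sq r
  rw [(mem_Elat hlam).mp hp] at e1
  rw [(mem_Elat hlam).mp hq] at e2
  rw [(mem_Elat hlam).mp hr] at e3
  set D : ℤ := (q - p).1 * (r - p).2 - (q - p).2 * (r - p).1 with hD
  have hid : ‖latC (q - p)‖ ^ 2 * ‖latC (r - p)‖ ^ 2 * ‖latC (q - r)‖ ^ 2 =
      4 * lam ^ 2 * (D : ℝ) ^ 2 := by
    rw [norm_latC_sq, norm_latC_sq, norm_latC_sq, hD]
    simp only [Prod.fst_sub, Prod.snd_sub]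
    push_cast
    obtain ⟨x, y⟩ := p
    obtain ⟨x', y'⟩ := q
    obtain ⟨x'', y''⟩ := r
    simp only at *
    set u : ℝ := (x' : ℝ) - x with hu
    set v : ℝ := (y' : ℝ) - y with hv
    set s : ℝ := (x'' : ℝ) - x with hs
    set t : ℝ := (y'' : ℝ) - y with ht
    have k1 : u ^ 2 + v ^ 2 = -2 * (x * u + y * v) := by
      rw [hu, hv]; linear_combination e1 - e2
    have k2 : s ^ 2 + t ^ 2 = -2 * (x * s + y * t) := by
      rw [hs, ht]; linear_combination e1 - e3
    have k3 : (x' : ℝ) - x'' = u - s := by rw [hu, hs]; ring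
    have k4 : (y' : ℝ) - y'' = v - t := by rw [hv, ht]; ring
    rw [k3, k4]
    have k5 : (u ^ 2 + v ^ 2) * (s ^ 2 + t ^ 2) * ((u - s) ^ 2 + (v - t) ^ 2) =
        ((u ^ 2 + v ^ 2) * s - (s ^ 2 + t ^ 2) * u) ^ 2 +
        ((u ^ 2 + v ^ 2) * t - (s ^ 2 + t ^ 2) * v) ^ 2 := by ring
    rw [k5, k1, k2, e1]
    ring
  have hne : ∀ {x y : ℤ × ℤ}, x ≠ y → 1 ≤ ‖latC (x - y)‖ := fun h =>
    one_le_norm_latC (sub_ne_zero.mpr h)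
  have hlam1 : 0 ≤ lam ^ 2 := by positivity
  have hD1 : (1 : ℝ) ≤ (D : ℝ) ^ 2 := by
    have : D ≠ 0 := by
      intro h0
      rw [h0] at hid
      have i1 := hne hpq.symm
      have i2 := hne hpr.symm
      have i3 := hne hqr
      have : 0 < ‖latC (q - p)‖ ^ 2 * ‖latC (r - p)‖ ^ 2 * ‖latC (q - r)‖ ^ 2 := by positivity
      rw [hid] at this
      simp at this
    have : 1 ≤ D ^ 2 := by have := sq_pos_of_ne_zero this; omega
    exact_mod_cast this
  have hle : ‖latC (q - p)‖ ^ 2 * ‖latC (r - p)‖ ^ 2 * ‖latC (q - r)‖ ^ 2 ≤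
      ρ ^ 2 * ρ ^ 2 * (2 * ρ) ^ 2 := by gcongr
  have : lam ^ 2 ≤ (ρ ^ 3) ^ 2 := by nlinarith
  exact (sq_le_sq₀ hlam (by positivity)).mp this

/-- Given three lattice vectors, at most two points of the circle nearly complete them to
a vanishing sum. -/
lemma card_filter_norm_add_le_two {m : ℝ} (hm : 3 ≤ m) (q : ℤ × ℤ) :
    ((Elat (m ^ 8)).filter fun p => ‖latC (q + p)‖ ≤ m ^ 2).card ≤ 2 := by
  by_contra! h
  obtain ⟨x, y, z, hx, hy, hz, hxy, hxz, hyz⟩ := Finset.two_lt_card_iff.mp h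
  simp only [Finset.mem_filter] at hx hy hz
  have hd : ∀ {x y : ℤ × ℤ}, ‖latC (q + x)‖ ≤ m ^ 2 → ‖latC (q + y)‖ ≤ m ^ 2 →
      ‖latC (y - x)‖ ≤ 2 * m ^ 2 := by
    intro x y h1 h2
    have : latC (y - x) = latC (q + y) - latC (q + x) := by
      rw [← latC_sub]; congr 1; abel
    rw [this]
    linarith [norm_sub_le (latC (q + y)) (latC (q + x))]
  have := le_pow_three_of_mem_Elat (by positivity) hx.1 hy.1 hz.1 hxy hxz hyz
    (hd hx.2 hy.2) (hd hx.2 hz.2)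
  have h6 : 0 < m ^ 6 := by positivity
  have h8 : m ^ 8 = m ^ 6 * m ^ 2 := by ring
  have h9 : 9 ≤ m ^ 2 := by nlinarith
  nlinarith

/-- Each lattice point on the circle has at most one close neighbour. -/
lemma card_filter_norm_sub_le_one {m : ℝ} (hm : 3 ≤ m) {p : ℤ × ℤ} (hp : p ∈ Elat (m ^ 8)) :
    ((Elat (m ^ 8)).filter fun q => q ≠ p ∧ ‖latC (q - p)‖ ≤ m ^ 2).card ≤ 1 := by
  by_contra! h
  obtain ⟨x, hx, y, hy, hxy⟩ := Finset.one_lt_card.mp h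
  simp only [Finset.mem_filter] at hx hy
  have := le_pow_three_of_mem_Elat (by positivity) hp hx.1 hy.1 hx.2.1.symm hy.2.1.symm hxy
    hx.2.2 hy.2.2
  have h6 : 0 < m ^ 6 := by positivity
  have h8 : m ^ 8 = m ^ 6 * m ^ 2 := by ring
  have h9 : 9 ≤ m ^ 2 := by nlinarith
  nlinarith

/-- Any set of points of `Elat lam` of diameter at most `√lam` has at most `Bmax lam` elements. -/
lemma card_le_Bmax {lam : ℝ} (hlam : 0 ≤ lam) {S : Finset (ℤ × ℤ)} (hS : S ⊆ Elat lam)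
    (hd : ∀ p ∈ S, ∀ q ∈ S, ‖latC p - latC q‖ ≤ √lam) : S.card ≤ Bmax lam := by
  classical
  rcases S.eq_empty_or_nonempty with rfl | ⟨p, hp⟩
  · simp
  have hmem : ((Elat lam).filter fun ξ => e2 (iv ξ - iv p) ≤ √lam).card ≤ Bmax lam := by
    rw [Bmax]
    refine le_csSup ⟨(Elat lam).card, ?_⟩ ⟨iv p, ?_, ?_⟩
    · rintro n ⟨x, -, rfl⟩
      exact Finset.card_filter_le _ _
    · have := (mem_Elat hlam).mp (hS hp)
      rw [e2_eq_norm]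
      exact this
    · congr
  refine le_trans (Finset.card_le_card fun q hq => ?_) hmem
  rw [Finset.mem_filter, e2_iv_sub_iv]
  exact ⟨hS hq, hd q hq p hp⟩

/-- Symmetric Schur test. -/
lemma schur_test {ι : Type*} (X : Finset ι) (κ : ι → ι → ℝ) (f r : ι → ℝ) {R : ℝ}
    (hκ : ∀ x ∈ X, ∀ y ∈ X, 0 ≤ κ x y) (hsymm : ∀ x ∈ X, ∀ y ∈ X, κ x y = κ y x)
    (hr : ∀ x, 0 < r x) (h : ∀ x ∈ X, ∑ y ∈ X, κ x y * (r x / r y) ≤ R) :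
    ∑ x ∈ X, ∑ y ∈ X, κ x y * (f x * f y) ≤ R * ∑ x ∈ X, f x ^ 2 := by
  have hpt : ∀ x ∈ X, ∀ y ∈ X, κ x y * (f x * f y) ≤
      (κ x y * (r x / r y) * f x ^ 2) / 2 + (κ y x * (r y / r x) * f y ^ 2) / 2 := by
    intro x hx y hy
    rw [hsymm y hy x hx]
    have h1 : f x * f y ≤ (r x / r y * f x ^ 2 + r y / r x * f y ^ 2) / 2 := by
      have hx0 := hr x
      have hy0 := hr y
      have : (r x / r y * f x ^ 2 + r y / r x * f y ^ 2) / 2 - f x * f y =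
          (r x * f x - r y * f y) ^ 2 / (2 * (r x * r y)) := by
        field_simp
        ring
      have : 0 ≤ (r x * f x - r y * f y) ^ 2 / (2 * (r x * r y)) := by positivity
      linarith
    have := mul_le_mul_of_nonneg_left h1 (hκ x hx y hy)
    linarith
  have hS : ∑ x ∈ X, ∑ y ∈ X, κ x y * (r x / r y) * f x ^ 2 ≤ R * ∑ x ∈ X, f x ^ 2 := by
    rw [Finset.mul_sum]
    refine Finset.sum_le_sum fun x hx => ?_
    rw [← Finset.sum_mul]
    exact mul_le_mul_of_nonneg_right (h x hx) (sq_nonneg _)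
  calc ∑ x ∈ X, ∑ y ∈ X, κ x y * (f x * f y)
      ≤ ∑ x ∈ X, ∑ y ∈ X, ((κ x y * (r x / r y) * f x ^ 2) / 2 +
          (κ y x * (r y / r x) * f y ^ 2) / 2) :=
        Finset.sum_le_sum fun x hx => Finset.sum_le_sum fun y hy => hpt x hx y hy
    _ = ∑ x ∈ X, ∑ y ∈ X, κ x y * (r x / r y) * f x ^ 2 := by
        simp only [Finset.sum_add_distrib]
        rw [Finset.sum_comm (f := fun x y => (κ y x * (r y / r x) * f y ^ 2) / 2)]
        simp only [← Finset.sum_div]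
        ring
    _ ≤ _ := hS

lemma one_div_sqrt_mul_le {a b : ℝ} (ha : 0 ≤ a) (hb : 1 ≤ b) :
    1 / √((a + 1) * b) ≤ 4 * (√(a + 1) / (√(a + 1) + √(b - 1)) - √a / (√a + √b)) := by
  rw [Real.sqrt_mul (by positivity)]
  have hX2 := Real.sq_sqrt (show 0 ≤ a + 1 by linarith)
  have hY2 := Real.sq_sqrt (show 0 ≤ b - 1 by linarith)
  have hx2 := Real.sq_sqrt ha
  have hy2 := Real.sq_sqrt (show 0 ≤ b by linarith)
  have hX : 0 < √(a + 1) := Real.sqrt_pos.mpr (by linarith)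
  have hy : 0 < √b := Real.sqrt_pos.mpr (by linarith)
  have hx := Real.sqrt_nonneg a
  have hY := Real.sqrt_nonneg (b - 1)
  have hxX : √a ≤ √(a + 1) := Real.sqrt_le_sqrt (by linarith)
  have hYy : √(b - 1) ≤ √b := Real.sqrt_le_sqrt (by linarith)
  generalize √(a + 1) = X at *
  generalize √(b - 1) = Y at *
  generalize √a = x at *
  generalize √b = y at *
  have hXY : 0 < X + Y := by linarith
  have hxy : 0 < x + y := by linarith
  have h1 : x * Y ≤ X * y := by gcongr
  have h2 : (X * y + x * Y) * (X * y - x * Y) = x ^ 2 + y ^ 2 := by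
    have : (X * y + x * Y) * (X * y - x * Y) = X ^ 2 * y ^ 2 - x ^ 2 * Y ^ 2 := by ring
    rw [this, hX2, hY2, hx2, hy2]; ring
  have h3 : (X + Y) * (x + y) ≤ 2 * (x ^ 2 + y ^ 2) := by
    nlinarith [sq_nonneg (X - Y), sq_nonneg (x - y), sq_nonneg (X + Y - (x + y))]
  have h4 : 2 * ((X * y + x * Y) * (X * y - x * Y)) ≤ 4 * (X * y) * (X * y - x * Y) := by
    nlinarith [mul_nonneg (sub_nonneg.mpr h1) (sub_nonneg.mpr h1)]
  rw [div_sub_div _ _ hXY.ne' hxy.ne', ← mul_div_assoc, div_le_div_iff₀ (by positivity)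
    (by positivity)]
  nlinarith

lemma sqrt_div_sqrt_mul_add_le {u d : ℝ} (hu : 0 < u) (hd : 1 ≤ d) :
    √u / (√d * (u + d)) ≤ 4 * (√d / (√u + √d) - √(d - 1) / (√u + √(d - 1))) := by
  have hX2 := Real.sq_sqrt (show 0 ≤ d by linarith)
  have hx2 := Real.sq_sqrt (show 0 ≤ d - 1 by linarith)
  have hU2 := Real.sq_sqrt hu.le
  have hX : 0 < √d := Real.sqrt_pos.mpr (by linarith)
  have hU : 0 < √u := Real.sqrt_pos.mpr hu
  have hx := Real.sqrt_nonneg (d - 1)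
  have hxX : √(d - 1) ≤ √d := Real.sqrt_le_sqrt (by linarith)
  generalize √d = X at *
  generalize √(d - 1) = x at *
  generalize √u = U at *
  have h1 : (X - x) * (2 * X) ≥ 1 := by
    have : (X - x) * (X + x) = 1 := by nlinarith
    nlinarith
  have h2 : (U + X) * (U + x) ≤ 2 * (u + d) := by nlinarith [sq_nonneg (U - X)]
  rw [div_sub_div _ _ (by positivity) (by positivity), ← mul_div_assoc,
    div_le_div_iff₀ (by positivity) (by positivity)]
  have h3 : X * (U + x) - (U + X) * x = U * (X - x) := by ring
  rw [h3]
  have h4 : (U + X) * (U + x) ≤ 2 * (u + d) * ((X - x) * (2 * X)) := by nlinarith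
  nlinarith [mul_le_mul_of_nonneg_left h4 hU.le]

lemma sum_range_sqrt_kernel_le (I n : ℕ) :
    ∑ j ∈ Finset.range n,
      √((1 + (I : ℝ)) / ((1 + j) * (1 + |(j : ℝ) - I|) * (1 + j + I))) ≤ 8 := by
  set H : ℕ → ℝ := fun j => √(j : ℝ) / (√(j : ℝ) + √((I : ℝ) + 1 - j)) +
    √((j : ℝ) - I - 1) / (√(1 + (I : ℝ)) + √((j : ℝ) - I - 1)) with hH
  have hdiv : ∀ x y : ℝ, 0 ≤ x → 0 ≤ y → 0 ≤ x / (x + y) ∧ x / (x + y) ≤ 1 := fun x y hx hy =>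
    ⟨by positivity, div_le_one_of_le₀ (by linarith) (by positivity)⟩
  have hH0 : ∀ j, 0 ≤ H j := fun j => by simp only [hH]; positivity
  have hH2 : ∀ j, H j ≤ 2 := fun j => by
    have h1 := (hdiv (√(j : ℝ)) (√((I : ℝ) + 1 - j)) (by positivity) (by positivity)).2
    have h2 := (hdiv (√((j : ℝ) - I - 1)) (√(1 + (I : ℝ))) (by positivity) (by positivity)).2
    simp only [hH]
    rw [add_comm (√(1 + (I : ℝ)))]
    linarith
  have hstep : ∀ j : ℕ, √((1 + (I : ℝ)) / ((1 + j) * (1 + |(j : ℝ) - I|) * (1 + j + I))) ≤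
      4 * (H (j + 1) - H j) := by
    intro j
    rcases le_or_gt j I with hj | hj
    · have hj' : (j : ℝ) ≤ I := by exact_mod_cast hj
      have h1 := one_div_sqrt_mul_le (a := j) (b := I + 1 - j) (by positivity) (by linarith)
      have h2 : H (j + 1) - H j = √((j : ℝ) + 1) / (√((j : ℝ) + 1) + √((I : ℝ) + 1 - j - 1)) -
          √(j : ℝ) / (√(j : ℝ) + √((I : ℝ) + 1 - j)) := by
        simp only [hH]
        push_cast
        rw [Real.sqrt_eq_zero_of_nonpos (show (j : ℝ) + 1 - I - 1 ≤ 0 by linarith),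
          Real.sqrt_eq_zero_of_nonpos (show (j : ℝ) - I - 1 ≤ 0 by linarith), zero_div,
          show (I : ℝ) + 1 - (j + 1) = I + 1 - j - 1 by ring]
        ring
      rw [h2]
      refine le_trans ?_ h1
      rw [← Real.sqrt_one, ← Real.sqrt_div zero_le_one, Real.sqrt_one]
      apply Real.sqrt_le_sqrt
      rw [abs_of_nonpos (by linarith), div_le_div_iff₀
        (mul_pos (mul_pos (by positivity) (by linarith)) (by positivity))
        (mul_pos (by positivity) (by linarith))]
      have hp : 0 ≤ (1 + (j : ℝ)) * (1 + -((j : ℝ) - I)) := mul_nonneg (by positivity) (by linarith)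
      nlinarith [mul_nonneg hp (Nat.cast_nonneg (α := ℝ) j)]
    · have hj' : (I : ℝ) + 1 ≤ j := by exact_mod_cast hj
      have h1 := sqrt_div_sqrt_mul_add_le (u := 1 + I) (d := j - I) (by positivity) (by linarith)
      have h2 : H (j + 1) - H j = √((j : ℝ) - I) / (√(1 + (I : ℝ)) + √((j : ℝ) - I)) -
          √((j : ℝ) - I - 1) / (√(1 + (I : ℝ)) + √((j : ℝ) - I - 1)) := by
        simp only [hH]
        push_cast
        rw [Real.sqrt_eq_zero_of_nonpos (show (I : ℝ) + 1 - (j + 1) ≤ 0 by linarith),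
          Real.sqrt_eq_zero_of_nonpos (show (I : ℝ) + 1 - j ≤ 0 by linarith), add_zero, add_zero,
          div_self (Real.sqrt_pos.mpr (by linarith)).ne',
          div_self (Real.sqrt_pos.mpr (by linarith)).ne',
          show (j : ℝ) + 1 - I - 1 = j - I by ring]
        ring
      rw [h2]
      refine le_trans ?_ h1
      have hd : 0 ≤ (j : ℝ) - I := by linarith
      have h3 : √(1 + (I : ℝ)) / (√((j : ℝ) - I) * (1 + I + (j - I))) =
          √((1 + (I : ℝ)) / ((j - I) * (1 + j) ^ 2)) := by
        rw [Real.sqrt_div (by positivity), Real.sqrt_mul hd, Real.sqrt_sq (by positivity)]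
        congr 2
        ring
      rw [h3]
      apply Real.sqrt_le_sqrt
      rw [abs_of_nonneg hd]
      have : 0 < (j : ℝ) - I := by linarith
      apply div_le_div_of_nonneg_left (by positivity) (by positivity)
      have h4 : ((j : ℝ) - I) * (1 + j) ≤ (1 + (j - I)) * (1 + j + I) := by
        have hI := Nat.cast_nonneg (α := ℝ) I
        exact mul_le_mul (by linarith) (by linarith) (by positivity) (by positivity)
      nlinarith [mul_le_mul_of_nonneg_left h4 (show (0 : ℝ) ≤ 1 + j by positivity)]
  calc _ ≤ ∑ j ∈ Finset.range n, 4 * (H (j + 1) - H j) := Finset.sum_le_sum fun j _ => hstep j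
    _ = 4 * (H n - H 0) := by rw [← Finset.mul_sum, Finset.sum_range_sub]
    _ ≤ 8 := by linarith [hH0 0, hH2 n]

/-- The weight of the `j`-th bucket relative to the `I`-th one in the Schur test. -/
def bucketWeight (I j : ℕ) : ℝ :=
  (if |(j : ℝ) - I| ≤ 1 then 3 else 0) +
    528 * √((1 + (I : ℝ)) / ((1 + j) * (1 + |(j : ℝ) - I|) * (1 + j + I)))

lemma bucketWeight_nonneg (I j : ℕ) : 0 ≤ bucketWeight I j := by
  unfold bucketWeight
  split_ifs <;> positivity

lemma sum_bucketWeight_le (I n : ℕ) : ∑ j ∈ Finset.range n, bucketWeight I j ≤ 4233 := by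
  have h1 : ∑ j ∈ Finset.range n, (if |(j : ℝ) - I| ≤ 1 then (3 : ℝ) else 0) ≤ 9 := by
    rw [← Finset.sum_filter, Finset.sum_const, nsmul_eq_mul]
    have : ((Finset.range n).filter fun j : ℕ => |(j : ℝ) - I| ≤ 1).card ≤ 3 := by
      refine (Finset.card_le_card (t := Finset.Icc (I - 1) (I + 1)) fun j hj => ?_).trans
        (by rw [Nat.card_Icc]; omega)
      have h := abs_le.mp (Finset.mem_filter.mp hj).2
      have h2 : (j : ℝ) ≤ I + 1 := by linarith [h.2]
      have h3 : (I : ℝ) ≤ j + 1 := by linarith [h.1]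
      have h2' : j ≤ I + 1 := by exact_mod_cast h2
      have h3' : I ≤ j + 1 := by exact_mod_cast h3
      rw [Finset.mem_Icc]
      omega
    have : (((Finset.range n).filter fun j : ℕ => |(j : ℝ) - I| ≤ 1).card : ℝ) ≤ 3 := by
      exact_mod_cast this
    linarith
  have h2 := sum_range_sqrt_kernel_le I n
  simp only [bucketWeight, Finset.sum_add_distrib, ← Finset.mul_sum]
  linarith

lemma mul_le_bucketWeight {K w x ρ i t : ℝ} (hw : 0 ≤ w) (hK : w ≤ K)
    (hx : w * √x ≤ K) (hi : 0 ≤ i) (ht : 0 ≤ t) (hxt : |t ^ 2 - i ^ 2| ≤ 4356 * x)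
    (hρ : ρ ≤ 2 * √((1 + i) / (1 + t))) : w * ρ ≤ K * bucketWeight ⌊i⌋₊ ⌊t⌋₊ := by
  have hK0 : 0 ≤ K := hw.trans hK
  have hi1 := Nat.floor_le hi
  have hi2 := (Nat.lt_floor_add_one i).le
  have ht1 := Nat.floor_le ht
  have ht2 := (Nat.lt_floor_add_one t).le
  unfold bucketWeight
  generalize ⌊i⌋₊ = I at *
  generalize ⌊t⌋₊ = j at *
  have hI0 := Nat.cast_nonneg (α := ℝ) I
  have hj0 := Nat.cast_nonneg (α := ℝ) j
  have hs0 := Real.sqrt_nonneg ((1 + (I : ℝ)) / ((1 + j) * (1 + |(j : ℝ) - I|) * (1 + j + I)))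
  rcases lt_or_ge |t - i| 1 with h | h
  · have hjI : |(j : ℝ) - I| ≤ 1 := by
      have h1 := abs_lt.mp h
      have h2 : (j : ℝ) < I + 2 := by linarith
      have h3 : (I : ℝ) < j + 2 := by linarith
      have h2' : j < I + 2 := by exact_mod_cast h2
      have h3' : I < j + 2 := by exact_mod_cast h3
      have h4 : (j : ℝ) ≤ I + 1 := by exact_mod_cast (show j ≤ I + 1 by omega)
      have h5 : (I : ℝ) ≤ j + 1 := by exact_mod_cast (show I ≤ j + 1 by omega)
      exact abs_le.mpr ⟨by linarith, by linarith⟩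
    rw [if_pos hjI]
    have h3 : ρ ≤ 3 := by
      refine hρ.trans ?_
      have : √((1 + i) / (1 + t)) ≤ 3 / 2 := by
        rw [Real.sqrt_le_left (by norm_num), div_le_iff₀ (by positivity)]
        have := (abs_lt.mp h).1
        nlinarith
      linarith
    calc w * ρ ≤ w * 3 := by gcongr
      _ ≤ K * 3 := by gcongr
      _ ≤ _ := by
        gcongr
        linarith
  · have hxpos : 0 < x := by
      have : 0 < |t ^ 2 - i ^ 2| := by
        rw [show t ^ 2 - i ^ 2 = (t - i) * (t + i) by ring, abs_mul]
        have : |t - i| ≤ |t + i| := by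
          rw [abs_of_nonneg (add_nonneg ht hi)]
          exact abs_le.mpr ⟨by linarith, by linarith⟩
        have : 0 < |t + i| := by linarith
        positivity
      linarith
    have hq : (1 + i) / ((1 + t) * x) ≤
        264 ^ 2 * ((1 + (I : ℝ)) / ((1 + j) * (1 + |(j : ℝ) - I|) * (1 + j + I))) := by
      have hab : |t - i| ≤ t + i := abs_le.mpr ⟨by linarith, by linarith⟩
      have hsq : |t ^ 2 - i ^ 2| = |t - i| * (t + i) := by
        rw [show t ^ 2 - i ^ 2 = (t - i) * (t + i) by ring, abs_mul,
          abs_of_nonneg (add_nonneg ht hi)]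
      have hd1 : |(j : ℝ) - I| ≤ |t - i| + 1 := by
        rw [abs_le]
        constructor <;> cases abs_cases (t - i) <;> linarith
      have k1 : 1 + |(j : ℝ) - I| ≤ 3 * |t - i| := by linarith
      have k2 : 1 + (j : ℝ) + I ≤ 2 * (t + i) := by linarith
      have k3 : (1 + |(j : ℝ) - I|) * (1 + j + I) ≤ 6 * (4356 * x) := by
        calc (1 + |(j : ℝ) - I|) * (1 + j + I) ≤ (3 * |t - i|) * (2 * (t + i)) := by gcongr
          _ = 6 * |t ^ 2 - i ^ 2| := by rw [hsq]; ring
          _ ≤ _ := by gcongr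
      have k4 : 1 + i ≤ 2 * (1 + I) := by linarith
      rw [← mul_div_assoc, div_le_div_iff₀ (by positivity) (by positivity)]
      calc (1 + i) * ((1 + (j : ℝ)) * (1 + |(j : ℝ) - I|) * (1 + j + I))
          = (1 + i) * (1 + (j : ℝ)) * ((1 + |(j : ℝ) - I|) * (1 + j + I)) := by ring
        _ ≤ (2 * (1 + I)) * (1 + t) * (6 * (4356 * x)) := by gcongr
        _ ≤ 264 ^ 2 * (1 + I) * ((1 + t) * x) := by
          have : 0 ≤ (1 + (I : ℝ)) * ((1 + t) * x) := by positivity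
          nlinarith
    have hwx : w ≤ K / √x := by
      rw [le_div_iff₀ (Real.sqrt_pos.mpr hxpos)]
      exact hx
    have hρ' : ρ / √x ≤ 528 *
        √((1 + (I : ℝ)) / ((1 + j) * (1 + |(j : ℝ) - I|) * (1 + j + I))) := by
      calc ρ / √x ≤ 2 * √((1 + i) / (1 + t)) / √x := by gcongr
        _ = 2 * √((1 + i) / ((1 + t) * x)) := by
          rw [mul_div_assoc, ← Real.sqrt_div (by positivity), div_div]
        _ ≤ 2 * √(264 ^ 2 *
            ((1 + (I : ℝ)) / ((1 + j) * (1 + |(j : ℝ) - I|) * (1 + j + I)))) := by gcongr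
        _ = _ := by
          rw [Real.sqrt_mul (by positivity), Real.sqrt_sq (by norm_num)]
          ring
    rcases le_or_gt ρ 0 with hρ0 | hρ0
    · have h1 : w * ρ ≤ 0 := mul_nonpos_of_nonneg_of_nonpos hw hρ0
      refine h1.trans (mul_nonneg hK0 ?_)
      split_ifs <;> positivity
    · calc w * ρ ≤ K / √x * ρ := by gcongr
        _ = K * (ρ / √x) := by ring
        _ ≤ K * (528 *
            √((1 + (I : ℝ)) / ((1 + j) * (1 + |(j : ℝ) - I|) * (1 + j + I)))) := by gcongr
        _ ≤ _ := by
          gcongr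
          split_ifs <;> linarith

lemma norm_add_mul_norm_add_mul_norm_add_le {r : ℝ} (hr : 0 < r) {z₁ z₂ z₃ z₄ : ℂ}
    (h₁ : ‖z₁‖ = r) (h₂ : ‖z₂‖ = r) (h₃ : ‖z₃‖ = r) (h₄ : ‖z₄‖ = r) :
    ‖z₃ + z₁‖ * ‖z₃ + z₂‖ * ‖z₃ + z₄‖ ≤ 2 * r ^ 2 * ‖z₁ + z₂ + (z₃ + z₄)‖ := by
  have hc : ∀ {z : ℂ}, ‖z‖ = r → z * starRingEnd ℂ z = (r : ℂ) ^ 2 := fun h => by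
    rw [Complex.mul_conj', h]
  have hid : (r : ℂ) ^ 2 * ((z₃ + z₁) * (z₃ + z₂) * (z₃ + z₄)) =
      (r : ℂ) ^ 2 * z₃ ^ 2 * (z₁ + z₂ + (z₃ + z₄)) +
      z₁ * z₂ * z₃ * z₄ * starRingEnd ℂ (z₁ + z₂ + (z₃ + z₄)) := by
    simp only [map_add]
    linear_combination (-z₂ * z₃ * z₄) * hc h₁ - z₁ * z₃ * z₄ * hc h₂ - z₁ * z₂ * z₄ * hc h₃ -
      z₁ * z₂ * z₃ * hc h₄
  have hn := congrArg (fun z : ℂ => ‖z‖) hid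
  simp only [norm_mul, norm_pow, Complex.norm_real, Real.norm_of_nonneg hr.le] at hn
  have hle := norm_add_le ((r : ℂ) ^ 2 * z₃ ^ 2 * (z₁ + z₂ + (z₃ + z₄)))
    (z₁ * z₂ * z₃ * z₄ * starRingEnd ℂ (z₁ + z₂ + (z₃ + z₄)))
  rw [← hn] at hle
  simp only [norm_mul, norm_pow, Complex.norm_real, Real.norm_of_nonneg hr.le, RCLike.norm_conj,
    h₁, h₂, h₃, h₄] at hle
  have hr2 : 0 < r ^ 2 := by positivity
  refine le_of_mul_le_mul_left ?_ hr2
  linarith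

lemma norm_sub_le_mul_abs_im_sub {r : ℝ} (hr : 0 < r) {z w : ℂ} (hz : ‖z‖ = r) (hw : ‖w‖ = r)
    (hz' : z.re ≤ -(r / 32)) (hw' : w.re ≤ -(r / 32)) : ‖z - w‖ ≤ 33 * |z.im - w.im| := by
  have e1 : z.re ^ 2 + z.im ^ 2 = r ^ 2 := by
    rw [← hz, Complex.sq_norm, Complex.normSq_apply]; ring
  have e2 : w.re ^ 2 + w.im ^ 2 = r ^ 2 := by
    rw [← hw, Complex.sq_norm, Complex.normSq_apply]; ring
  have k1 : |z.im + w.im| ≤ 2 * r := by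
    have h1 := Complex.abs_im_le_norm z
    have h2 := Complex.abs_im_le_norm w
    have := abs_add_le z.im w.im
    linarith
  have k2 : r / 16 ≤ |z.re + w.re| := by
    rw [abs_of_neg (by linarith)]
    linarith
  have k3 : |z.re - w.re| * |z.re + w.re| = |z.im - w.im| * |z.im + w.im| := by
    rw [← abs_mul, ← abs_mul, ← abs_neg]
    congr 1
    linear_combination e2 - e1
  have k4 : |z.re - w.re| ≤ 32 * |z.im - w.im| := by
    have : |z.re - w.re| * (r / 16) ≤ |z.im - w.im| * (2 * r) := by
      calc |z.re - w.re| * (r / 16) ≤ |z.re - w.re| * |z.re + w.re| := by gcongr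
        _ = _ := k3
        _ ≤ _ := by gcongr
    nlinarith
  have := Complex.norm_le_abs_re_add_abs_im (z - w)
  rw [Complex.sub_re, Complex.sub_im] at this
  linarith

/-- In rotated coordinates, points of the half circle whose distance to the axis lies in a given
window of length `√r / 33` are at most `2 * Bmax r`. -/
lemma card_bucket_le {r : ℝ} (hr : 0 < r) {e : ℂ} (he : ‖e‖ = 1) (j : ℕ) :
    ((Elat r).filter fun p => (latC p * e).re ≤ -(r / 32) ∧
      ⌊|(latC p * e).im| / (√r / 33)⌋₊ = j).card ≤ 2 * Bmax r := by
  have hh : 0 < √r / 33 := by have := Real.sqrt_pos.mpr hr; positivity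
  have hwin : ∀ v : ℝ, ⌊|v| / (√r / 33)⌋₊ = j →
      j * (√r / 33) ≤ |v| ∧ |v| ≤ j * (√r / 33) + √r / 33 := by
    intro v hv
    have h1 := Nat.floor_le (show 0 ≤ |v| / (√r / 33) by positivity)
    have h2 := (Nat.lt_floor_add_one (|v| / (√r / 33))).le
    rw [hv] at h1 h2
    rw [le_div_iff₀ hh] at h1
    rw [div_le_iff₀ hh] at h2
    exact ⟨h1, by linarith⟩
  have hdist : ∀ p ∈ Elat r, ∀ q ∈ Elat r, (latC p * e).re ≤ -(r / 32) →
      (latC q * e).re ≤ -(r / 32) → |(latC p * e).im - (latC q * e).im| ≤ √r / 33 →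
      ‖latC p - latC q‖ ≤ √r := by
    intro p hp q hq h1 h2 h3
    have hn : ∀ {p}, p ∈ Elat r → ‖latC p * e‖ = r := fun hp => by
      rw [norm_mul, he, mul_one, (mem_Elat hr.le).mp hp]
    have h4 := norm_sub_le_mul_abs_im_sub hr (hn hp) (hn hq) h1 h2
    rw [← sub_mul, norm_mul, he, mul_one] at h4
    linarith
  rw [← Finset.card_filter_add_card_filter_not (fun p => 0 ≤ (latC p * e).im), two_mul]
  refine add_le_add (card_le_Bmax hr.le ?_ ?_) (card_le_Bmax hr.le ?_ ?_)
  · exact (Finset.filter_subset _ _).trans (Finset.filter_subset _ _)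
  · intro p hp q hq
    simp only [Finset.mem_filter] at hp hq
    obtain ⟨⟨hp, hp1, hp2⟩, hp3⟩ := hp
    obtain ⟨⟨hq, hq1, hq2⟩, hq3⟩ := hq
    have a1 := hwin _ hp2
    have a2 := hwin _ hq2
    rw [abs_of_nonneg hp3] at a1
    rw [abs_of_nonneg hq3] at a2
    exact hdist p hp q hq hp1 hq1 (abs_le.mpr ⟨by linarith, by linarith⟩)
  · exact (Finset.filter_subset _ _).trans (Finset.filter_subset _ _)
  · intro p hp q hq
    simp only [Finset.mem_filter, not_le] at hp hq
    obtain ⟨⟨hp, hp1, hp2⟩, hp3⟩ := hp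
    obtain ⟨⟨hq, hq1, hq2⟩, hq3⟩ := hq
    have a1 := hwin _ hp2
    have a2 := hwin _ hq2
    rw [abs_of_neg hp3] at a1
    rw [abs_of_neg hq3] at a2
    exact hdist p hp q hq hp1 hq1 (abs_le.mpr ⟨by linarith, by linarith⟩)

/-- The weight of a pair of lattice points in the Schur test. -/
def pairWeight (lam : ℝ) (x : (ℤ × ℤ) × (ℤ × ℤ)) : ℝ :=
  √(1 + ‖latC x.1 - latC x.2‖ / (√lam / 33))

lemma pairWeight_pos (lam : ℝ) (x : (ℤ × ℤ) × (ℤ × ℤ)) : 0 < pairWeight lam x := by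
  unfold pairWeight
  positivity

/-- The kernel `w` restricted to nearly cancelling quadruples made of two nondegenerate pairs. -/
def pairKernel (m : ℝ) (w : ℤ × ℤ → ℝ) (x y : (ℤ × ℤ) × (ℤ × ℤ)) : ℝ :=
  if ‖latC (x.1 + x.2 + (y.1 + y.2))‖ ≤ m ^ 2 ∧ m ^ 8 / 2 ≤ ‖latC (x.1 + x.2)‖ ∧
    m ^ 8 / 2 ≤ ‖latC (y.1 + y.2)‖ then w (x.1 + x.2 + (y.1 + y.2)) else 0

lemma re_le_of_near {m : ℝ} (hm : 66 ≤ m) {z₁ z₂ z₃ z₄ e : ℂ}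
    (h₃ : ‖z₃‖ = m ^ 8) (h₄ : ‖z₄‖ = m ^ 8)
    (hnear : ‖z₁ + z₂ + (z₃ + z₄)‖ ≤ m ^ 2) (h34 : m ^ 8 / 2 ≤ ‖z₃ + z₄‖)
    (hs0 : 0 < ‖z₁ + z₂‖) (hs : ‖z₁ + z₂‖ ≤ 2 * m ^ 8)
    (he : e = starRingEnd ℂ (z₁ + z₂) / ‖z₁ + z₂‖) :
    (z₃ * e).re ≤ -(m ^ 8 / 32) := by
  have hre : ∀ a b : ℂ, ‖a + b‖ ^ 2 = ‖a‖ ^ 2 + ‖b‖ ^ 2 + 2 * (a * starRingEnd ℂ b).re := by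
    intro a b
    simp only [Complex.sq_norm, Complex.normSq_apply, Complex.add_re, Complex.add_im,
      Complex.mul_re, Complex.conj_re, Complex.conj_im]
    ring
  have hself : (z₃ * starRingEnd ℂ z₃).re = ‖z₃‖ ^ 2 := by
    rw [Complex.mul_conj']; norm_cast
  set ξ := z₁ + z₂ + (z₃ + z₄) with hξ
  have k1 : z₃ * starRingEnd ℂ (z₁ + z₂) = z₃ * starRingEnd ℂ ξ - z₃ * starRingEnd ℂ z₃ -
      z₃ * starRingEnd ℂ z₄ := by
    rw [hξ]; simp only [map_add]; ring
  have k2 : (z₃ * starRingEnd ℂ ξ).re ≤ m ^ 8 * m ^ 2 := by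
    refine (Complex.re_le_norm _).trans ?_
    rw [norm_mul, RCLike.norm_conj, h₃]
    gcongr
  have k3 := hre z₃ z₄
  rw [h₃, h₄] at k3
  have k4 : (m ^ 8 / 2) ^ 2 ≤ ‖z₃ + z₄‖ ^ 2 := by gcongr
  have hm6 : (16 : ℝ) ≤ m ^ 6 := by
    calc (16 : ℝ) ≤ 66 ^ 6 := by norm_num
      _ ≤ m ^ 6 := by gcongr
  have k5 : m ^ 2 ≤ m ^ 8 / 16 := by
    have : 0 ≤ m ^ 2 := by positivity
    have h8 : m ^ 8 = m ^ 2 * m ^ 6 := by ring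
    rw [h8]; nlinarith
  have k6 : (z₃ * starRingEnd ℂ (z₁ + z₂)).re ≤ -((m ^ 8) ^ 2 / 16) := by
    rw [k1, Complex.sub_re, Complex.sub_re, hself, h₃]
    have : m ^ 8 * m ^ 2 ≤ m ^ 8 * (m ^ 8 / 16) := by gcongr
    nlinarith
  have k7 : (z₃ * e).re = (z₃ * starRingEnd ℂ (z₁ + z₂)).re / ‖z₁ + z₂‖ := by
    rw [he, ← mul_div_assoc, Complex.div_ofReal_re]
  rw [k7, div_le_iff₀ hs0]
  have h8 : 0 < m ^ 8 := by positivity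
  nlinarith

lemma pairKernel_mul_le {m K : ℝ} (hm : 66 ≤ m) {w : ℤ × ℤ → ℝ} (hw0 : ∀ ξ, 0 ≤ w ξ)
    (hwK : ∀ ξ, w ξ ≤ K) (hwd : ∀ ξ, w ξ * √‖latC ξ‖ ≤ K) {p₁ p₂ p₃ p₄ : ℤ × ℤ}
    (h₁ : p₁ ∈ Elat (m ^ 8)) (h₂ : p₂ ∈ Elat (m ^ 8)) (h₃ : p₃ ∈ Elat (m ^ 8))
    (h₄ : p₄ ∈ Elat (m ^ 8)) {e : ℂ}
    (he : e = starRingEnd ℂ (latC p₁ + latC p₂) / ‖latC p₁ + latC p₂‖)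
    (hnear : ‖latC p₁ + latC p₂ + (latC p₃ + latC p₄)‖ ≤ m ^ 2)
    (hs : 0 < ‖latC p₁ + latC p₂‖) (h34 : m ^ 8 / 2 ≤ ‖latC p₃ + latC p₄‖) :
    w (p₁ + p₂ + (p₃ + p₄)) *
      (pairWeight (m ^ 8) (p₁, p₂) / pairWeight (m ^ 8) (p₃, p₄)) ≤
    K * bucketWeight ⌊|(latC p₁ * e).im| / (√(m ^ 8) / 33)⌋₊
      ⌊|(latC p₃ * e).im| / (√(m ^ 8) / 33)⌋₊ := by
  have hm0 : 0 < m := by linarith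
  have h8 : 0 < m ^ 8 := by positivity
  rw [mem_Elat h8.le] at h₁ h₂ h₃ h₄
  have hxi : latC (p₁ + p₂ + (p₃ + p₄)) = latC p₁ + latC p₂ + (latC p₃ + latC p₄) := by
    simp only [latC_add]
  have hsq : √(m ^ 8) = m ^ 4 := by
    rw [show m ^ 8 = (m ^ 4) ^ 2 by ring, Real.sqrt_sq (by positivity)]
  have hpw : ∀ p q : ℤ × ℤ, pairWeight (m ^ 8) (p, q) =
      √(1 + ‖latC p - latC q‖ / (m ^ 4 / 33)) := fun p q => by rw [pairWeight, hsq]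
  have hw1 := hwd (p₁ + p₂ + (p₃ + p₄))
  rw [hxi] at hw1
  rw [hsq, hpw, hpw]
  set h : ℝ := m ^ 4 / 33 with hh
  have hhpos : 0 < h := by positivity
  clear_value h
  generalize latC p₁ = z₁ at *
  generalize latC p₂ = z₂ at *
  generalize latC p₃ = z₃ at *
  generalize latC p₄ = z₄ at *
  have hen : ‖e‖ = 1 := by
    rw [he, norm_div, RCLike.norm_conj, Complex.norm_real, norm_norm, div_self hs.ne']
  have hv12 : (z₂ * e).im = -(z₁ * e).im := by
    have : ((z₁ + z₂) * e).im = 0 := by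
      rw [he, ← mul_div_assoc, Complex.mul_conj', Complex.div_ofReal_im]
      norm_cast
      simp
    rw [add_mul, Complex.add_im] at this
    linarith
  have hu12 : (z₁ * e).re = (z₂ * e).re := by
    have h0 : ((z₁ - z₂) * starRingEnd ℂ (z₁ + z₂)).re = 0 := by
      have : ((z₁ - z₂) * starRingEnd ℂ (z₁ + z₂)).re = ‖z₁‖ ^ 2 - ‖z₂‖ ^ 2 := by
        simp only [Complex.sq_norm, Complex.normSq_apply, Complex.mul_re, Complex.sub_re,
          Complex.sub_im, Complex.conj_re, Complex.conj_im, Complex.add_re, Complex.add_im]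
        ring
      rw [this, h₁, h₂, sub_self]
    have : ((z₁ - z₂) * e).re = 0 := by
      rw [he, ← mul_div_assoc, Complex.div_ofReal_re, h0, zero_div]
    rw [sub_mul, Complex.sub_re] at this
    linarith
  have hD12 : ‖z₁ - z₂‖ ≤ 2 * |(z₁ * e).im| := by
    have : ‖z₁ - z₂‖ = ‖(z₁ - z₂) * e‖ := by rw [norm_mul, hen, mul_one]
    rw [this]
    refine (Complex.norm_le_abs_re_add_abs_im _).trans ?_
    rw [sub_mul, Complex.sub_re, Complex.sub_im, hu12, hv12, sub_self, abs_zero, zero_add,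
      sub_neg_eq_add, ← two_mul, abs_mul, abs_two]
  have hm2h : m ^ 2 ≤ h := by
    have : m ^ 4 = m ^ 2 * m ^ 2 := by ring
    have h33 : 33 ≤ m ^ 2 := by nlinarith
    rw [hh, this]
    nlinarith
  have hD34 : 2 * |(z₃ * e).im| - h ≤ ‖z₃ - z₄‖ := by
    have k1 : (z₃ * e).im + (z₄ * e).im = ((z₁ + z₂ + (z₃ + z₄)) * e).im := by
      simp only [add_mul, Complex.add_im, hv12]; ring
    have k2 : |((z₁ + z₂ + (z₃ + z₄)) * e).im| ≤ h := by
      refine (Complex.abs_im_le_norm _).trans ?_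
      rw [norm_mul, hen, mul_one]
      linarith
    have k3 : |(z₃ * e).im - (z₄ * e).im| ≤ ‖z₃ - z₄‖ := by
      rw [← Complex.sub_im, ← sub_mul]
      refine (Complex.abs_im_le_norm _).trans ?_
      rw [norm_mul, hen, mul_one]
    rw [← k1] at k2
    have k4 := abs_add_le ((z₃ * e).im - (z₄ * e).im) ((z₃ * e).im + (z₄ * e).im)
    rw [show (z₃ * e).im - (z₄ * e).im + ((z₃ * e).im + (z₄ * e).im) = 2 * (z₃ * e).im by ring,
      abs_mul, abs_two] at k4
    linarith
  refine mul_le_bucketWeight (hw0 _) (hwK _) hw1 (by positivity) (by positivity) ?_ ?_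
  · have hprod := norm_add_mul_norm_add_mul_norm_add_le h8 h₁ h₂ h₃ h₄
    have k1 : |(z₃ * e).im + (z₁ * e).im| ≤ ‖z₃ + z₁‖ := by
      rw [← Complex.add_im, ← add_mul]
      refine (Complex.abs_im_le_norm _).trans ?_
      rw [norm_mul, hen, mul_one]
    have k2 : |(z₃ * e).im - (z₁ * e).im| ≤ ‖z₃ + z₂‖ := by
      rw [sub_eq_add_neg, ← hv12, ← Complex.add_im, ← add_mul]
      refine (Complex.abs_im_le_norm _).trans ?_
      rw [norm_mul, hen, mul_one]
    have k3 : |(z₃ * e).im + (z₁ * e).im| * |(z₃ * e).im - (z₁ * e).im| * (m ^ 8 / 2) ≤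
        2 * (m ^ 8) ^ 2 * ‖z₁ + z₂ + (z₃ + z₄)‖ := by
      refine le_trans ?_ hprod
      gcongr
    rw [← abs_mul] at k3
    have k4 : |((z₃ * e).im + (z₁ * e).im) * ((z₃ * e).im - (z₁ * e).im)| ≤
        4 * m ^ 8 * ‖z₁ + z₂ + (z₃ + z₄)‖ := by
      refine le_of_mul_le_mul_right ?_ (half_pos h8)
      linarith
    rw [div_pow, div_pow, sq_abs, sq_abs, ← sub_div, abs_div,
      abs_of_pos (show 0 < h ^ 2 by positivity), div_le_iff₀ (by positivity)]
    have k5 : h ^ 2 = m ^ 8 / 1089 := by rw [hh]; ring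
    rw [k5, show (z₃ * e).im ^ 2 - (z₁ * e).im ^ 2 =
      ((z₃ * e).im + (z₁ * e).im) * ((z₃ * e).im - (z₁ * e).im) by ring]
    linarith
  · rw [← Real.sqrt_div (by positivity), show (2 : ℝ) = √4 by
      rw [show (4 : ℝ) = 2 ^ 2 by norm_num, Real.sqrt_sq (by norm_num)],
      ← Real.sqrt_mul (by norm_num)]
    apply Real.sqrt_le_sqrt
    have k1 : ‖z₁ - z₂‖ / h ≤ 2 * (|(z₁ * e).im| / h) := by
      rw [← mul_div_assoc]; gcongr
    have k2 : 2 * (|(z₃ * e).im| / h) - 1 ≤ ‖z₃ - z₄‖ / h := by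
      rw [le_div_iff₀ hhpos, sub_mul, mul_assoc, div_mul_cancel₀ _ hhpos.ne', one_mul]
      exact hD34
    have k3 : 0 ≤ ‖z₃ - z₄‖ / h := by positivity
    have k4 : 0 ≤ |(z₁ * e).im| / h := by positivity
    have k5 : 0 ≤ |(z₃ * e).im| / h := by positivity
    generalize ‖z₁ - z₂‖ / h = D at *
    generalize ‖z₃ - z₄‖ / h = D' at *
    generalize |(z₁ * e).im| / h = i at *
    generalize |(z₃ * e).im| / h = t at *
    rw [← mul_div_assoc, div_le_div_iff₀ (by positivity) (by positivity)]
    calc (1 + D) * (1 + t) ≤ (1 + 2 * i) * (1 + t) := by gcongr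
      _ ≤ (2 * (1 + i)) * (2 * (1 + D')) := by
        apply mul_le_mul _ _ (by positivity) (by positivity) <;> linarith
      _ = 4 * (1 + i) * (1 + D') := by ring

lemma sum_pairKernel_le {m K : ℝ} (hm : 66 ≤ m) {w : ℤ × ℤ → ℝ} (hw0 : ∀ ξ, 0 ≤ w ξ)
    (hwK : ∀ ξ, w ξ ≤ K) (hwd : ∀ ξ, w ξ * √‖latC ξ‖ ≤ K) {x : (ℤ × ℤ) × (ℤ × ℤ)}
    (hx : x ∈ Elat (m ^ 8) ×ˢ Elat (m ^ 8)) :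
    ∑ y ∈ Elat (m ^ 8) ×ˢ Elat (m ^ 8),
      pairKernel m w x y * (pairWeight (m ^ 8) x / pairWeight (m ^ 8) y) ≤
      16932 * K * Bmax (m ^ 8) := by
  have hK : 0 ≤ K := (hw0 0).trans (hwK 0)
  have h8 : 0 < m ^ 8 := by positivity
  obtain ⟨p₁, p₂⟩ := x
  obtain ⟨h₁, h₂⟩ := Finset.mem_product.mp hx
  simp only at h₁ h₂
  rcases lt_or_ge ‖latC (p₁ + p₂)‖ (m ^ 8 / 2) with hlt | hge
  · rw [Finset.sum_eq_zero]
    · positivity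
    · intro y _
      rw [pairKernel, if_neg (fun h => absurd h.2.1 (not_le.mpr hlt)), zero_mul]
  rw [latC_add] at hge
  have hs : 0 < ‖latC p₁ + latC p₂‖ := by linarith
  have hs2 : ‖latC p₁ + latC p₂‖ ≤ 2 * m ^ 8 := by
    refine (norm_add_le _ _).trans ?_
    rw [(mem_Elat h8.le).mp h₁, (mem_Elat h8.le).mp h₂]
    linarith
  set e : ℂ := starRingEnd ℂ (latC p₁ + latC p₂) / ‖latC p₁ + latC p₂‖ with he
  have hen : ‖e‖ = 1 := by
    rw [he, norm_div, RCLike.norm_conj, Complex.norm_real, norm_norm, div_self hs.ne']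
  set j : ℤ × ℤ → ℕ := fun p => ⌊|(latC p * e).im| / (√(m ^ 8) / 33)⌋₊ with hj
  set E' := (Elat (m ^ 8)).filter fun p => (latC p * e).re ≤ -(m ^ 8 / 32) with hE'
  have hinner : ∀ p₃ ∈ Elat (m ^ 8), ∑ p₄ ∈ Elat (m ^ 8), pairKernel m w (p₁, p₂) (p₃, p₄) *
      (pairWeight (m ^ 8) (p₁, p₂) / pairWeight (m ^ 8) (p₃, p₄)) ≤
      if (latC p₃ * e).re ≤ -(m ^ 8 / 32) then 2 * (K * bucketWeight (j p₁) (j p₃)) else 0 := by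
    intro p₃ h₃
    split_ifs with hre
    · have hb : 0 ≤ K * bucketWeight (j p₁) (j p₃) := mul_nonneg hK (bucketWeight_nonneg _ _)
      calc _ ≤ ∑ p₄ ∈ Elat (m ^ 8), if ‖latC (p₁ + p₂ + p₃ + p₄)‖ ≤ m ^ 2 then
            K * bucketWeight (j p₁) (j p₃) else 0 := by
            refine Finset.sum_le_sum fun p₄ h₄ => ?_
            unfold pairKernel
            split_ifs with hc hn hn
            · obtain ⟨c1, c2, c3⟩ := hc
              simp only [latC_add] at c1 c3
              exact pairKernel_mul_le hm hw0 hwK hwd h₁ h₂ h₃ h₄ he c1 hs c3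
            · exact absurd (by rw [add_assoc]; exact hc.1) hn
            · rw [zero_mul]; exact hb
            · rw [zero_mul]
        _ = ((Elat (m ^ 8)).filter fun p => ‖latC (p₁ + p₂ + p₃ + p)‖ ≤ m ^ 2).card *
            (K * bucketWeight (j p₁) (j p₃)) := by
            rw [← Finset.sum_filter, Finset.sum_const, nsmul_eq_mul]
        _ ≤ 2 * (K * bucketWeight (j p₁) (j p₃)) := by
            gcongr
            exact_mod_cast card_filter_norm_add_le_two (by linarith) _
    · refine le_of_eq (Finset.sum_eq_zero fun p₄ h₄ => ?_)
      rw [pairKernel, if_neg, zero_mul]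
      rintro ⟨c1, -, c3⟩
      simp only [latC_add] at c1 c3
      exact hre (re_le_of_near hm ((mem_Elat h8.le).mp h₃) ((mem_Elat h8.le).mp h₄) c1 c3 hs hs2 he)
  rw [Finset.sum_product]
  have hmaps : ∀ p ∈ E', j p ∈ Finset.range (E'.sup j + 1) := fun p hp =>
    Finset.mem_range.mpr (Nat.lt_succ_of_le (Finset.le_sup hp))
  calc _ ≤ ∑ p₃ ∈ Elat (m ^ 8), if (latC p₃ * e).re ≤ -(m ^ 8 / 32) then
        2 * (K * bucketWeight (j p₁) (j p₃)) else 0 := Finset.sum_le_sum hinner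
    _ = ∑ i ∈ Finset.range (E'.sup j + 1), ∑ p ∈ E' with j p = i,
        2 * (K * bucketWeight (j p₁) (j p)) := by
        rw [← Finset.sum_filter, Finset.sum_fiberwise_of_maps_to hmaps]
    _ ≤ ∑ i ∈ Finset.range (E'.sup j + 1),
        (2 * Bmax (m ^ 8) : ℝ) * (2 * (K * bucketWeight (j p₁) i)) := by
        refine Finset.sum_le_sum fun i _ => ?_
        rw [Finset.sum_congr rfl fun p hp => by rw [(Finset.mem_filter.mp hp).2],
          Finset.sum_const, nsmul_eq_mul]
        have := bucketWeight_nonneg (j p₁) i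
        gcongr
        rw [hE', Finset.filter_filter]
        exact_mod_cast card_bucket_le h8 hen i
    _ = 4 * K * Bmax (m ^ 8) * ∑ i ∈ Finset.range (E'.sup j + 1), bucketWeight (j p₁) i := by
        rw [Finset.mul_sum]
        exact Finset.sum_congr rfl fun i _ => by ring
    _ ≤ 4 * K * Bmax (m ^ 8) * 4233 := by
        gcongr
        exact sum_bucketWeight_le _ _
    _ = _ := by ring

lemma sum_pow_four_eq (E : Finset (ℤ × ℤ)) (f : ℤ × ℤ → ℝ) :
    ∑ p₁ ∈ E, ∑ p₂ ∈ E, ∑ p₃ ∈ E, ∑ p₄ ∈ E, f p₁ * f p₂ * (f p₃ * f p₄) =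
      (∑ p ∈ E, f p) ^ 4 := by
  simp only [← Finset.mul_sum, ← Finset.sum_mul]
  ring

lemma sum_sq_le_card_mul (E : Finset (ℤ × ℤ)) (f : ℤ × ℤ → ℝ) :
    (∑ p ∈ E, f p) ^ 2 ≤ E.card * ∑ p ∈ E, f p ^ 2 :=
  sq_sum_le_card_mul_sum_sq

/-- Among four points of a large circle which nearly sum to zero, the first one can be paired with
another one so that neither pair is nearly antipodal. -/
lemma exists_nondegenerate_pairing {r M : ℝ} (hM : M ≤ r / 2) {z₁ z₂ z₃ z₄ : ℂ}
    (h₁ : ‖z₁‖ = r) (h₂ : ‖z₂‖ = r) (h₃ : ‖z₃‖ = r) (h₄ : ‖z₄‖ = r)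
    (hnear : ‖z₁ + z₂ + (z₃ + z₄)‖ ≤ M) :
    (r / 2 ≤ ‖z₁ + z₂‖ ∧ r / 2 ≤ ‖z₃ + z₄‖) ∨ (r / 2 ≤ ‖z₁ + z₃‖ ∧ r / 2 ≤ ‖z₂ + z₄‖) ∨
      (r / 2 ≤ ‖z₁ + z₄‖ ∧ r / 2 ≤ ‖z₂ + z₃‖) := by
  have hr : 0 ≤ r := h₁ ▸ norm_nonneg z₁
  have hsum : ‖z₁ + z₂‖ ^ 2 + ‖z₁ + z₃‖ ^ 2 + ‖z₁ + z₄‖ ^ 2 =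
      2 * ‖z₁‖ ^ 2 + ‖z₂‖ ^ 2 + ‖z₃‖ ^ 2 + ‖z₄‖ ^ 2 - ‖z₁‖ ^ 2 +
      2 * (z₁ * starRingEnd ℂ (z₁ + z₂ + (z₃ + z₄))).re := by
    simp only [Complex.sq_norm, Complex.normSq_apply, Complex.add_re, Complex.add_im, map_add,
      Complex.mul_re, Complex.conj_re, Complex.conj_im]
    ring
  have hre : -(r * M) ≤ (z₁ * starRingEnd ℂ (z₁ + z₂ + (z₃ + z₄))).re := by
    have h := Complex.abs_re_le_norm (z₁ * starRingEnd ℂ (z₁ + z₂ + (z₃ + z₄)))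
    rw [norm_mul, RCLike.norm_conj, h₁] at h
    have h' : r * ‖z₁ + z₂ + (z₃ + z₄)‖ ≤ r * M := by gcongr
    linarith [(abs_le.mp h).1]
  have hrM : r * M ≤ r * (r / 2) := by gcongr
  have hbig : r ≤ ‖z₁ + z₂‖ ∨ r ≤ ‖z₁ + z₃‖ ∨ r ≤ ‖z₁ + z₄‖ := by
    by_contra! h
    obtain ⟨a, b, c⟩ := h
    have a' := pow_lt_pow_left₀ a (norm_nonneg _) two_ne_zero
    have b' := pow_lt_pow_left₀ b (norm_nonneg _) two_ne_zero
    have c' := pow_lt_pow_left₀ c (norm_nonneg _) two_ne_zero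
    rw [h₁, h₂, h₃, h₄] at hsum
    linarith
  have hcomp : ∀ a b : ℂ, ‖a + b‖ ≤ M → r ≤ ‖a‖ → r / 2 ≤ ‖a‖ ∧ r / 2 ≤ ‖b‖ := by
    intro a b hab ha
    have : ‖a‖ ≤ ‖a + b‖ + ‖b‖ := by
      have := norm_sub_le (a + b) b
      rwa [add_sub_cancel_right] at this
    exact ⟨by linarith, by linarith⟩
  rcases hbig with h | h | h
  · exact Or.inl (hcomp _ _ hnear h)
  · exact Or.inr (Or.inl (hcomp _ _ (by convert hnear using 2; ring) h))
  · exact Or.inr (Or.inr (hcomp _ _ (by convert hnear using 2; ring) h))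

lemma sum_quadruple_pairKernel_le {m K : ℝ} (hm : 66 ≤ m) {w : ℤ × ℤ → ℝ} (hw0 : ∀ ξ, 0 ≤ w ξ)
    (hwK : ∀ ξ, w ξ ≤ K) (hwd : ∀ ξ, w ξ * √‖latC ξ‖ ≤ K) (α : ℤ × ℤ → ℝ) :
    ∑ p₁ ∈ Elat (m ^ 8), ∑ p₂ ∈ Elat (m ^ 8), ∑ p₃ ∈ Elat (m ^ 8), ∑ p₄ ∈ Elat (m ^ 8),
      pairKernel m w (p₁, p₂) (p₃, p₄) * (α p₁ * α p₂ * (α p₃ * α p₄)) ≤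
      16932 * K * Bmax (m ^ 8) * (∑ p ∈ Elat (m ^ 8), α p ^ 2) ^ 2 := by
  have h := schur_test (Elat (m ^ 8) ×ˢ Elat (m ^ 8)) (pairKernel m w)
    (fun x => α x.1 * α x.2) (pairWeight (m ^ 8)) (R := 16932 * K * Bmax (m ^ 8)) ?_ ?_
    (pairWeight_pos _) (fun x hx => sum_pairKernel_le hm hw0 hwK hwd hx)
  · simp only [Finset.sum_product] at h
    refine h.trans_eq ?_
    congr 1
    simp only [mul_pow]
    rw [← Finset.sum_mul_sum, sq]
  · intro x _ y _
    unfold pairKernel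
    split_ifs
    exacts [hw0 _, le_rfl]
  · intro x _ y _
    unfold pairKernel
    rw [add_comm (y.1 + y.2)]
    congr 1
    rw [and_comm (a := m ^ 8 / 2 ≤ ‖latC (x.1 + x.2)‖)]

/-- The quadrilinear form with kernel `w` is bounded in terms of `Bmax`. -/
lemma sum_quadruple_le {m K C : ℝ} (hm : 66 ≤ m) {w : ℤ × ℤ → ℝ} (hw0 : ∀ ξ, 0 ≤ w ξ)
    (hwK : ∀ ξ, w ξ ≤ K) (hwd : ∀ ξ, w ξ * √‖latC ξ‖ ≤ K)
    (hC : ((Elat (m ^ 8)).card : ℝ) ^ 2 ≤ C * m) {α : ℤ × ℤ → ℝ} (hα : ∀ p, 0 ≤ α p) :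
    ∑ p₁ ∈ Elat (m ^ 8), ∑ p₂ ∈ Elat (m ^ 8), ∑ p₃ ∈ Elat (m ^ 8), ∑ p₄ ∈ Elat (m ^ 8),
      w (p₁ + p₂ + (p₃ + p₄)) * (α p₁ * α p₂ * (α p₃ * α p₄)) ≤
      (50796 * K * Bmax (m ^ 8) + K * C) * (∑ p ∈ Elat (m ^ 8), α p ^ 2) ^ 2 := by
  have hK : 0 ≤ K := (hw0 0).trans (hwK 0)
  have hm0 : 0 < m := by linarith
  have h8 : 0 < m ^ 8 := by positivity
  have hM : m ^ 2 ≤ m ^ 8 / 2 := by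
    have h1 : (2 : ℝ) ≤ m ^ 6 := by
      calc (2 : ℝ) ≤ 66 ^ 6 := by norm_num
        _ ≤ m ^ 6 := by gcongr
    have h2 : m ^ 8 = m ^ 2 * m ^ 6 := by ring
    have : 0 ≤ m ^ 2 := by positivity
    rw [h2]
    nlinarith
  set E := Elat (m ^ 8) with hE
  set g : ℤ × ℤ → ℤ × ℤ → ℤ × ℤ → ℤ × ℤ → ℝ := fun p₁ p₂ p₃ p₄ =>
    pairKernel m w (p₁, p₂) (p₃, p₄) * (α p₁ * α p₂ * (α p₃ * α p₄)) with hg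
  have hg0 : ∀ p₁ p₂ p₃ p₄, 0 ≤ g p₁ p₂ p₃ p₄ := by
    intro p₁ p₂ p₃ p₄
    have h1 := hα p₁
    have h2 := hα p₂
    have h3 := hα p₃
    have h4 := hα p₄
    have : 0 ≤ pairKernel m w (p₁, p₂) (p₃, p₄) := by
      unfold pairKernel
      split_ifs
      exacts [hw0 _, le_rfl]
    simp only [hg]
    positivity
  have hpt : ∀ p₁ ∈ E, ∀ p₂ ∈ E, ∀ p₃ ∈ E, ∀ p₄ ∈ E,
      w (p₁ + p₂ + (p₃ + p₄)) * (α p₁ * α p₂ * (α p₃ * α p₄)) ≤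
      g p₁ p₂ p₃ p₄ + g p₁ p₃ p₂ p₄ + g p₁ p₄ p₂ p₃ +
        K / m * (α p₁ * α p₂ * (α p₃ * α p₄)) := by
    intro p₁ h₁ p₂ h₂ p₃ h₃ p₄ h₄
    have a1 := hα p₁
    have a2 := hα p₂
    have a3 := hα p₃
    have a4 := hα p₄
    have hprod : 0 ≤ α p₁ * α p₂ * (α p₃ * α p₄) := by positivity
    have hKm : 0 ≤ K / m * (α p₁ * α p₂ * (α p₃ * α p₄)) := by positivity
    have b1 := hg0 p₁ p₂ p₃ p₄
    have b2 := hg0 p₁ p₃ p₂ p₄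
    have b3 := hg0 p₁ p₄ p₂ p₃
    rcases lt_or_ge (m ^ 2) ‖latC (p₁ + p₂ + (p₃ + p₄))‖ with hfar | hnear
    · have hs : m ≤ √‖latC (p₁ + p₂ + (p₃ + p₄))‖ := Real.le_sqrt_of_sq_le hfar.le
      have hw : w (p₁ + p₂ + (p₃ + p₄)) ≤ K / m := by
        rw [le_div_iff₀ hm0]
        refine le_trans ?_ (hwd (p₁ + p₂ + (p₃ + p₄)))
        have := hw0 (p₁ + p₂ + (p₃ + p₄))
        gcongr
      have := mul_le_mul_of_nonneg_right hw hprod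
      linarith
    · have e2 : p₁ + p₃ + (p₂ + p₄) = p₁ + p₂ + (p₃ + p₄) := by abel
      have e3 : p₁ + p₄ + (p₂ + p₃) = p₁ + p₂ + (p₃ + p₄) := by abel
      have hp := exists_nondegenerate_pairing hM ((mem_Elat h8.le).mp h₁)
        ((mem_Elat h8.le).mp h₂) ((mem_Elat h8.le).mp h₃) ((mem_Elat h8.le).mp h₄)
        (by simpa only [latC_add] using hnear)
      simp only [← latC_add] at hp
      rcases hp with hp | hp | hp
      · have : g p₁ p₂ p₃ p₄ = w (p₁ + p₂ + (p₃ + p₄)) * (α p₁ * α p₂ * (α p₃ * α p₄)) := by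
          simp only [hg]
          rw [pairKernel, if_pos ⟨hnear, hp⟩]
        linarith
      · have : g p₁ p₃ p₂ p₄ = w (p₁ + p₂ + (p₃ + p₄)) * (α p₁ * α p₂ * (α p₃ * α p₄)) := by
          simp only [hg]
          rw [pairKernel, if_pos ⟨by rw [e2]; exact hnear, hp⟩, e2]
          ring
        linarith
      · have : g p₁ p₄ p₂ p₃ = w (p₁ + p₂ + (p₃ + p₄)) * (α p₁ * α p₂ * (α p₃ * α p₄)) := by
          simp only [hg]
          rw [pairKernel, if_pos ⟨by rw [e3]; exact hnear, hp⟩, e3]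
          ring
        linarith
  set A := ∑ p ∈ E, α p ^ 2 with hA
  have hA0 : 0 ≤ A := Finset.sum_nonneg fun p _ => sq_nonneg _
  have hS := sum_quadruple_pairKernel_le hm hw0 hwK hwd α
  have hS2 : ∑ p₁ ∈ E, ∑ p₂ ∈ E, ∑ p₃ ∈ E, ∑ p₄ ∈ E, g p₁ p₃ p₂ p₄ =
      ∑ p₁ ∈ E, ∑ p₂ ∈ E, ∑ p₃ ∈ E, ∑ p₄ ∈ E, g p₁ p₂ p₃ p₄ :=
    Finset.sum_congr rfl fun p₁ _ => Finset.sum_comm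
  have hS3 : ∑ p₁ ∈ E, ∑ p₂ ∈ E, ∑ p₃ ∈ E, ∑ p₄ ∈ E, g p₁ p₄ p₂ p₃ =
      ∑ p₁ ∈ E, ∑ p₂ ∈ E, ∑ p₃ ∈ E, ∑ p₄ ∈ E, g p₁ p₂ p₃ p₄ := by
    refine Finset.sum_congr rfl fun p₁ _ => ?_
    rw [Finset.sum_congr rfl fun p₂ _ => Finset.sum_comm]
    exact Finset.sum_comm
  have hfar : K / m * (∑ p ∈ E, α p) ^ 4 ≤ K * C * A ^ 2 := by
    have h1 := sum_sq_le_card_mul E α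
    have h2 : (∑ p ∈ E, α p) ^ 4 ≤ C * m * A ^ 2 := by
      calc (∑ p ∈ E, α p) ^ 4 = ((∑ p ∈ E, α p) ^ 2) ^ 2 := by ring
        _ ≤ (E.card * A) ^ 2 := by gcongr
        _ = (E.card : ℝ) ^ 2 * A ^ 2 := by ring
        _ ≤ C * m * A ^ 2 := by gcongr
    calc K / m * (∑ p ∈ E, α p) ^ 4 ≤ K / m * (C * m * A ^ 2) := by gcongr
      _ = K * C * A ^ 2 := by field_simp
  calc _ ≤ ∑ p₁ ∈ E, ∑ p₂ ∈ E, ∑ p₃ ∈ E, ∑ p₄ ∈ E, (g p₁ p₂ p₃ p₄ + g p₁ p₃ p₂ p₄ +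
        g p₁ p₄ p₂ p₃ + K / m * (α p₁ * α p₂ * (α p₃ * α p₄))) :=
        Finset.sum_le_sum fun p₁ h₁ => Finset.sum_le_sum fun p₂ h₂ =>
          Finset.sum_le_sum fun p₃ h₃ => Finset.sum_le_sum fun p₄ h₄ =>
            hpt p₁ h₁ p₂ h₂ p₃ h₃ p₄ h₄
    _ = 3 * ∑ p₁ ∈ E, ∑ p₂ ∈ E, ∑ p₃ ∈ E, ∑ p₄ ∈ E, g p₁ p₂ p₃ p₄ +
        K / m * (∑ p ∈ E, α p) ^ 4 := by
        have h4 : ∑ p₁ ∈ E, ∑ p₂ ∈ E, ∑ p₃ ∈ E, ∑ p₄ ∈ E,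
            K / m * (α p₁ * α p₂ * (α p₃ * α p₄)) = K / m * (∑ p ∈ E, α p) ^ 4 := by
          rw [← sum_pow_four_eq]
          simp only [Finset.mul_sum]
        simp only [Finset.sum_add_distrib]
        rw [hS2, hS3, h4]
        ring
    _ ≤ _ := by linarith

/-- The off-diagonal part of the bilinear form with kernel `w`. -/
lemma sum_offDiag_le {m K C D : ℝ} (hm : 3 ≤ m) {w : ℤ × ℤ → ℝ} (hw0 : ∀ ξ, 0 ≤ w ξ)
    (hwK : ∀ ξ, w ξ ≤ K) (hwd : ∀ ξ, w ξ * √‖latC ξ‖ ≤ K) (hwD : ∀ ξ, ξ ≠ 0 → w ξ ≤ D)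
    (hC : ((Elat (m ^ 8)).card : ℝ) ^ 2 ≤ C * m) {α : ℤ × ℤ → ℝ} (hα : ∀ p, 0 ≤ α p) :
    ∑ p ∈ Elat (m ^ 8), ∑ q ∈ Elat (m ^ 8),
      (if q ≠ p then w (p - q) * (α p * α q) else 0) ≤
      (D + K * √C / √m) * ∑ p ∈ Elat (m ^ 8), α p ^ 2 := by
  have hK : 0 ≤ K := (hw0 0).trans (hwK 0)
  have hD : 0 ≤ D := (hw0 (1, 0)).trans (hwD (1, 0) (by simp))
  have hm0 : 0 < m := by linarith
  set E := Elat (m ^ 8) with hE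
  set A := ∑ p ∈ E, α p ^ 2 with hA
  have hA0 : 0 ≤ A := Finset.sum_nonneg fun p _ => sq_nonneg _
  have hnorm : ∀ p q : ℤ × ℤ, ‖latC (p - q)‖ = ‖latC (q - p)‖ := fun p q => by
    rw [latC_sub, latC_sub, norm_sub_rev]
  have hnear := schur_test E (fun p q => if q ≠ p ∧ ‖latC (q - p)‖ ≤ m ^ 2 then D else 0) α
    (fun _ => 1) (R := D) (fun p _ q _ => by split_ifs; exacts [hD, le_rfl])
    (fun p _ q _ => if_congr (by rw [hnorm q p, ne_comm]) rfl rfl) (fun _ => one_pos) (fun p hp => by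
      simp only [div_one, mul_one]
      rw [← Finset.sum_filter, Finset.sum_const, nsmul_eq_mul]
      have : (((E.filter fun q => q ≠ p ∧ ‖latC (q - p)‖ ≤ m ^ 2).card : ℕ) : ℝ) ≤ 1 := by
        exact_mod_cast card_filter_norm_sub_le_one hm hp
      nlinarith)
  have hfar : K / m * (∑ p ∈ E, α p) ^ 2 ≤ K * √C / √m * A := by
    have hN : (E.card : ℝ) ≤ √C * √m := by
      rw [← Real.sqrt_mul' C hm0.le]
      exact Real.le_sqrt_of_sq_le hC
    calc K / m * (∑ p ∈ E, α p) ^ 2 ≤ K / m * (E.card * A) := by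
          have := sum_sq_le_card_mul E α
          gcongr
      _ ≤ K / m * (√C * √m * A) := by gcongr
      _ = K * √C * (√m / m) * A := by ring
      _ = _ := by rw [Real.sqrt_div_self', mul_one_div]
  have hpt : ∀ p ∈ E, ∀ q ∈ E, (if q ≠ p then w (p - q) * (α p * α q) else 0) ≤
      (if q ≠ p ∧ ‖latC (q - p)‖ ≤ m ^ 2 then D else 0) * (α p * α q) +
        K / m * (α p * α q) := by
    intro p _ q _
    have a1 := hα p
    have a2 := hα q
    have hprod : 0 ≤ α p * α q := by positivity
    have hKm : 0 ≤ K / m * (α p * α q) := by positivity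
    split_ifs with h1 h2 h2
    · have := mul_le_mul_of_nonneg_right (hwD _ (sub_ne_zero.mpr h1.symm)) hprod
      linarith
    · have hlt : m ^ 2 < ‖latC (p - q)‖ := by
        rw [hnorm]
        by_contra! h
        exact h2 ⟨h1, h⟩
      have hs : m ≤ √‖latC (p - q)‖ := Real.le_sqrt_of_sq_le hlt.le
      have hw : w (p - q) ≤ K / m := by
        rw [le_div_iff₀ hm0]
        refine le_trans ?_ (hwd (p - q))
        have := hw0 (p - q)
        gcongr
      have := mul_le_mul_of_nonneg_right hw hprod
      linarith
    · positivity
    · linarith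
  calc _ ≤ ∑ p ∈ E, ∑ q ∈ E, ((if q ≠ p ∧ ‖latC (q - p)‖ ≤ m ^ 2 then D else 0) * (α p * α q) +
        K / m * (α p * α q)) :=
        Finset.sum_le_sum fun p hp => Finset.sum_le_sum fun q hq => hpt p hp q hq
    _ = ∑ p ∈ E, ∑ q ∈ E, (if q ≠ p ∧ ‖latC (q - p)‖ ≤ m ^ 2 then D else 0) * (α p * α q) +
        K / m * (∑ p ∈ E, α p) ^ 2 := by
        have h2 : ∑ p ∈ E, ∑ q ∈ E, K / m * (α p * α q) = K / m * (∑ p ∈ E, α p) ^ 2 := by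
          rw [sq (∑ p ∈ E, α p), Finset.sum_mul_sum]
          simp only [Finset.mul_sum]
        simp only [Finset.sum_add_distrib]
        rw [h2]
    _ ≤ _ := by linarith

/-- The character of the torus with frequency `p`. -/
def latExp (p : ℤ × ℤ) (x : ℝ × ℝ) : ℂ :=
  Complex.exp (Complex.I * Complex.ofReal ((p.1 : ℝ) * x.1 + (p.2 : ℝ) * x.2))

lemma latExp_add (p q : ℤ × ℤ) (x : ℝ × ℝ) : latExp (p + q) x = latExp p x * latExp q x := by
  rw [latExp, latExp, latExp, ← Complex.exp_add]
  congr 1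
  push_cast [Prod.fst_add, Prod.snd_add]
  ring

lemma conj_latExp (p : ℤ × ℤ) (x : ℝ × ℝ) : starRingEnd ℂ (latExp p x) = latExp (-p) x := by
  rw [latExp, latExp, ← Complex.exp_conj, map_mul, Complex.conj_I, Complex.conj_ofReal]
  congr 1
  push_cast [Prod.fst_neg, Prod.snd_neg]
  ring

lemma norm_latExp (p : ℤ × ℤ) (x : ℝ × ℝ) : ‖latExp p x‖ = 1 := by
  rw [latExp, mul_comm, Complex.norm_exp_ofReal_mul_I]

lemma continuous_latExp (p : ℤ × ℤ) : Continuous (latExp p) := by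
  unfold latExp
  fun_prop

lemma efn_eq_sum (lam : ℝ) (c : ℤ × ℤ → ℂ) (x : ℝ × ℝ) :
    efn lam c x = ∑ p ∈ Elat lam, c p * latExp p x := rfl

lemma continuous_efn (lam : ℝ) (c : ℤ × ℤ → ℂ) : Continuous (efn lam c) := by
  simp only [funext (efn_eq_sum lam c)]
  exact continuous_finsetSum _ fun p _ => continuous_const.mul (continuous_latExp p)

lemma integrable_latExp {Ω : Type*} [MeasurableSpace Ω] {μ : Measure Ω} [IsFiniteMeasure μ]
    {g : Ω → ℝ × ℝ} (hg : Measurable g) (p : ℤ × ℤ) : Integrable (fun ω => latExp p (g ω)) μ :=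
  (integrable_const (1 : ℝ)).mono' ((continuous_latExp p).measurable.comp hg).aestronglyMeasurable
    (Filter.Eventually.of_forall fun ω => (norm_latExp p (g ω)).le)

lemma integral_norm_efn_sq {Ω : Type*} [MeasurableSpace Ω] {μ : Measure Ω} [IsFiniteMeasure μ]
    {g : Ω → ℝ × ℝ} (hg : Measurable g) (lam : ℝ) (c : ℤ × ℤ → ℂ) :
    ((∫ ω, ‖efn lam c (g ω)‖ ^ 2 ∂μ : ℝ) : ℂ) = ∑ p ∈ Elat lam, ∑ q ∈ Elat lam,
      c p * starRingEnd ℂ (c q) * ∫ ω, latExp (p - q) (g ω) ∂μ := by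
  have hpt : ∀ ω, ((‖efn lam c (g ω)‖ ^ 2 : ℝ) : ℂ) = ∑ p ∈ Elat lam, ∑ q ∈ Elat lam,
      c p * starRingEnd ℂ (c q) * latExp (p - q) (g ω) := by
    intro ω
    rw [Complex.ofReal_pow, ← Complex.mul_conj', efn_eq_sum, map_sum, Finset.sum_mul_sum]
    refine Finset.sum_congr rfl fun p _ => Finset.sum_congr rfl fun q _ => ?_
    rw [map_mul, conj_latExp, sub_eq_add_neg, latExp_add]
    ring
  rw [← integral_complex_ofReal]
  simp only [hpt]
  rw [integral_finsetSum _ fun p _ => integrable_finsetSum _ fun q _ =>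
    (integrable_latExp hg _).const_mul _]
  refine Finset.sum_congr rfl fun p _ => ?_
  rw [integral_finsetSum _ fun q _ => (integrable_latExp hg _).const_mul _]
  exact Finset.sum_congr rfl fun q _ => integral_const_mul _ _

lemma conj_efn {lam : ℝ} (hlam : 0 ≤ lam) {c : ℤ × ℤ → ℂ}
    (hc : ∀ p, c (-p) = starRingEnd ℂ (c p)) (x : ℝ × ℝ) :
    starRingEnd ℂ (efn lam c x) = efn lam c x := by
  rw [efn_eq_sum, map_sum]
  refine Finset.sum_bij' (fun p _ => -p) (fun p _ => -p) (fun p hp => neg_mem_Elat hlam hp)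
    (fun p hp => neg_mem_Elat hlam hp) (fun p _ => neg_neg p) (fun p _ => neg_neg p) ?_
  intro p _
  rw [map_mul, conj_latExp, hc]

lemma integral_norm_efn_pow_four {Ω : Type*} [MeasurableSpace Ω] {μ : Measure Ω}
    [IsFiniteMeasure μ] {g : Ω → ℝ × ℝ} (hg : Measurable g) {lam : ℝ} (hlam : 0 ≤ lam)
    {c : ℤ × ℤ → ℂ} (hc : ∀ p, c (-p) = starRingEnd ℂ (c p)) :
    ((∫ ω, ‖efn lam c (g ω)‖ ^ 4 ∂μ : ℝ) : ℂ) = ∑ p₁ ∈ Elat lam, ∑ p₂ ∈ Elat lam,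
      ∑ p₃ ∈ Elat lam, ∑ p₄ ∈ Elat lam, c p₁ * c p₂ * (c p₃ * c p₄) *
        ∫ ω, latExp (p₁ + p₂ + (p₃ + p₄)) (g ω) ∂μ := by
  have hpt : ∀ ω, ((‖efn lam c (g ω)‖ ^ 4 : ℝ) : ℂ) = ∑ p₁ ∈ Elat lam, ∑ p₂ ∈ Elat lam,
      ∑ p₃ ∈ Elat lam, ∑ p₄ ∈ Elat lam, c p₁ * c p₂ * (c p₃ * c p₄) *
        latExp (p₁ + p₂ + (p₃ + p₄)) (g ω) := by
    intro ω
    have h1 : ∀ p₁ p₂ p₃ p₄, c p₁ * c p₂ * (c p₃ * c p₄) * latExp (p₁ + p₂ + (p₃ + p₄)) (g ω) =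
        (c p₁ * latExp p₁ (g ω)) * (c p₂ * latExp p₂ (g ω)) *
        ((c p₃ * latExp p₃ (g ω)) * (c p₄ * latExp p₄ (g ω))) := by
      intro p₁ p₂ p₃ p₄
      simp only [latExp_add]
      ring
    simp only [h1, ← Finset.mul_sum, ← Finset.sum_mul, ← efn_eq_sum]
    have h2 := Complex.mul_conj' (efn lam c (g ω))
    rw [conj_efn hlam hc] at h2
    rw [h2]
    push_cast
    ring
  rw [← integral_complex_ofReal]
  simp only [hpt]
  have hi : ∀ (z : ℂ) (p : ℤ × ℤ), Integrable (fun ω => z * latExp p (g ω)) μ := fun z p =>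
    (integrable_latExp hg p).const_mul z
  rw [integral_finsetSum _ fun p₁ _ => integrable_finsetSum _ fun p₂ _ =>
    integrable_finsetSum _ fun p₃ _ => integrable_finsetSum _ fun p₄ _ => hi _ _]
  refine Finset.sum_congr rfl fun p₁ _ => ?_
  rw [integral_finsetSum _ fun p₂ _ => integrable_finsetSum _ fun p₃ _ =>
    integrable_finsetSum _ fun p₄ _ => hi _ _]
  refine Finset.sum_congr rfl fun p₂ _ => ?_
  rw [integral_finsetSum _ fun p₃ _ => integrable_finsetSum _ fun p₄ _ => hi _ _]
  refine Finset.sum_congr rfl fun p₃ _ => ?_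
  rw [integral_finsetSum _ fun p₄ _ => hi _ _]
  exact Finset.sum_congr rfl fun p₄ _ => integral_const_mul _ _

lemma setIntegral_exp_int_mul (n : ℤ) :
    ∫ x in Set.Icc (0 : ℝ) (2 * π), Complex.exp (Complex.I * Complex.ofReal ((n : ℝ) * x)) =
      if n = 0 then (2 * π : ℝ) else 0 := by
  rw [integral_Icc_eq_integral_Ioc, ← intervalIntegral.integral_of_le (by positivity)]
  split_ifs with hn
  · simp [hn]
  · have hc : Complex.I * (n : ℂ) ≠ 0 := mul_ne_zero Complex.I_ne_zero (by exact_mod_cast hn)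
    have h := integral_exp_mul_complex (a := 0) (b := 2 * π) hc
    have h1 : ∀ x : ℝ, Complex.exp (Complex.I * Complex.ofReal ((n : ℝ) * x)) =
        Complex.exp (Complex.I * (n : ℂ) * x) := fun x => by
      congr 1
      push_cast
      ring
    simp only [h1]
    rw [h]
    have h2 : Complex.I * (n : ℂ) * ((2 * π : ℝ) : ℂ) = n * (2 * π * Complex.I) := by
      push_cast
      ring
    rw [h2, Complex.exp_int_mul_two_pi_mul_I]
    simp

lemma setIntegral_latExp (p : ℤ × ℤ) :
    ∫ x in (Set.Icc (0 : ℝ) (2 * π)) ×ˢ (Set.Icc (0 : ℝ) (2 * π)), latExp p x =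
      if p = 0 then ((2 * π : ℝ) : ℂ) ^ 2 else 0 := by
  have h : ∀ x : ℝ × ℝ, latExp p x =
      Complex.exp (Complex.I * Complex.ofReal ((p.1 : ℝ) * x.1)) *
      Complex.exp (Complex.I * Complex.ofReal ((p.2 : ℝ) * x.2)) := fun x => by
    rw [latExp, ← Complex.exp_add]
    congr 1
    push_cast
    ring
  simp only [h]
  rw [Measure.volume_eq_prod, setIntegral_prod_mul
    (fun x : ℝ => Complex.exp (Complex.I * Complex.ofReal ((p.1 : ℝ) * x)))
    (fun x : ℝ => Complex.exp (Complex.I * Complex.ofReal ((p.2 : ℝ) * x))),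
    setIntegral_exp_int_mul, setIntegral_exp_int_mul]
  by_cases h1 : p.1 = 0 <;> by_cases h2 : p.2 = 0 <;> simp [h1, h2, Prod.ext_iff, sq]

lemma l2T_efn (lam : ℝ) (c : ℤ × ℤ → ℂ) :
    l2T (efn lam c) = 2 * π * √(∑ p ∈ Elat lam, ‖c p‖ ^ 2) := by
  have hfin : IsFiniteMeasure ((volume : Measure (ℝ × ℝ)).restrict
      ((Set.Icc (0 : ℝ) (2 * π)) ×ˢ (Set.Icc (0 : ℝ) (2 * π)))) :=
    ⟨by
      rw [Measure.restrict_apply_univ]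
      exact (isCompact_Icc.prod isCompact_Icc).measure_lt_top⟩
  have h := integral_norm_efn_sq (μ := (volume : Measure (ℝ × ℝ)).restrict
    ((Set.Icc (0 : ℝ) (2 * π)) ×ˢ (Set.Icc (0 : ℝ) (2 * π)))) measurable_id lam c
  simp only [id, setIntegral_latExp] at h
  have h2 : ∫ x in (Set.Icc (0 : ℝ) (2 * π)) ×ˢ (Set.Icc (0 : ℝ) (2 * π)),
      ‖efn lam c x‖ ^ 2 = (2 * π) ^ 2 * ∑ p ∈ Elat lam, ‖c p‖ ^ 2 := by
    apply Complex.ofReal_injective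
    have hr : (((2 * π) ^ 2 * ∑ p ∈ Elat lam, ‖c p‖ ^ 2 : ℝ) : ℂ) =
        ∑ p ∈ Elat lam, ((2 * π : ℝ) : ℂ) ^ 2 * (‖c p‖ : ℂ) ^ 2 := by
      push_cast
      rw [Finset.mul_sum]
    rw [h, hr]
    refine Finset.sum_congr rfl fun p hp => ?_
    rw [Finset.sum_eq_single p]
    · rw [sub_self, if_pos rfl, Complex.mul_conj', mul_comm]
    · intro q _ hq
      rw [if_neg (sub_ne_zero.mpr hq.symm), mul_zero]
    · exact fun hp' => absurd hp hp'
  rw [l2T, h2, Real.sqrt_mul (by positivity), Real.sqrt_sq (by positivity)]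

lemma setIntegral_latExp_comp (γ : ℝ → ℝ × ℝ) {s b : ℝ} (hsb : s ≤ b) (ξ : ℤ × ℤ) :
    ∫ t in Set.Ioc s b, latExp ξ (γ t) = curveHat γ s b ξ := by
  rw [curveHat, intervalIntegral.integral_of_le hsb]
  rfl

lemma integral_norm_efn_sq_curve_ge {γ : ℝ → ℝ × ℝ} (hγ : Continuous γ) {s b : ℝ} (hsb : s ≤ b)
    (lam : ℝ) (c : ℤ × ℤ → ℂ) :
    (b - s) * ∑ p ∈ Elat lam, ‖c p‖ ^ 2 - ∑ p ∈ Elat lam, ∑ q ∈ Elat lam,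
      (if q ≠ p then ‖curveHat γ s b (p - q)‖ * (‖c p‖ * ‖c q‖) else 0) ≤
      ∫ t in s..b, ‖efn lam c (γ t)‖ ^ 2 := by
  have h := integral_norm_efn_sq (μ := (volume : Measure ℝ).restrict (Set.Ioc s b))
    hγ.measurable lam c
  rw [← intervalIntegral.integral_of_le hsb] at h
  simp only [setIntegral_latExp_comp γ hsb] at h
  set X := ∫ t in s..b, ‖efn lam c (γ t)‖ ^ 2 with hX
  have hdiff : (((b - s) * ∑ p ∈ Elat lam, ‖c p‖ ^ 2 - X : ℝ) : ℂ) =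
      -∑ p ∈ Elat lam, ∑ q ∈ Elat lam,
        if q ≠ p then c p * starRingEnd ℂ (c q) * curveHat γ s b (p - q) else 0 := by
    rw [Complex.ofReal_sub, h, Complex.ofReal_mul, Complex.ofReal_sum, Finset.mul_sum,
      ← Finset.sum_sub_distrib, ← Finset.sum_neg_distrib]
    refine Finset.sum_congr rfl fun p hp => ?_
    rw [← Finset.add_sum_erase _ _ hp, ← Finset.add_sum_erase (Elat lam) (fun q =>
      if q ≠ p then c p * starRingEnd ℂ (c q) * curveHat γ s b (p - q) else 0) hp,
      Finset.sum_congr rfl fun q hq => if_pos (Finset.ne_of_mem_erase hq), sub_self, curveHat_zero,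
      Complex.mul_conj']
    push_cast
    simp only [ne_eq, not_true_eq_false, if_false]
    ring
  have hle : |(b - s) * ∑ p ∈ Elat lam, ‖c p‖ ^ 2 - X| ≤ ∑ p ∈ Elat lam, ∑ q ∈ Elat lam,
      (if q ≠ p then ‖curveHat γ s b (p - q)‖ * (‖c p‖ * ‖c q‖) else 0) := by
    rw [← Real.norm_eq_abs, ← Complex.norm_real, hdiff, norm_neg]
    refine (norm_sum_le _ _).trans (Finset.sum_le_sum fun p _ => (norm_sum_le _ _).trans
      (Finset.sum_le_sum fun q _ => ?_))
    split_ifs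
    · rw [norm_mul, norm_mul, RCLike.norm_conj, mul_comm]
    · rw [norm_zero]
  linarith [le_abs_self ((b - s) * ∑ p ∈ Elat lam, ‖c p‖ ^ 2 - X)]

lemma integral_norm_efn_pow_four_curve_le {γ : ℝ → ℝ × ℝ} (hγ : Continuous γ) {s b : ℝ}
    (hsb : s ≤ b) {lam : ℝ} (hlam : 0 ≤ lam) {c : ℤ × ℤ → ℂ}
    (hc : ∀ p, c (-p) = starRingEnd ℂ (c p)) :
    ∫ t in s..b, ‖efn lam c (γ t)‖ ^ 4 ≤ ∑ p₁ ∈ Elat lam, ∑ p₂ ∈ Elat lam,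
      ∑ p₃ ∈ Elat lam, ∑ p₄ ∈ Elat lam, ‖curveHat γ s b (p₁ + p₂ + (p₃ + p₄))‖ *
        (‖c p₁‖ * ‖c p₂‖ * (‖c p₃‖ * ‖c p₄‖)) := by
  have h := integral_norm_efn_pow_four (μ := (volume : Measure ℝ).restrict (Set.Ioc s b))
    hγ.measurable hlam hc
  rw [← intervalIntegral.integral_of_le hsb] at h
  simp only [setIntegral_latExp_comp γ hsb] at h
  refine (le_abs_self _).trans ?_
  rw [← Real.norm_eq_abs, ← Complex.norm_real, h]
  refine (norm_sum_le _ _).trans (Finset.sum_le_sum fun p₁ _ => (norm_sum_le _ _).trans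
    (Finset.sum_le_sum fun p₂ _ => (norm_sum_le _ _).trans (Finset.sum_le_sum fun p₃ _ =>
      (norm_sum_le _ _).trans (Finset.sum_le_sum fun p₄ _ => ?_))))
  simp only [norm_mul]
  rw [mul_comm]

/-- A lower bound for an `L¹` norm from an `L²` lower bound and an `L⁴` upper bound. -/
lemma integral_ge_of_sq_ge_of_pow_four_le {f : ℝ → ℝ} (hf : Continuous f) (hf0 : ∀ t, 0 ≤ f t)
    {s b κ C A B : ℝ} (hsb : s ≤ b) (hκ : 0 < κ) (hC : 0 < C) (hA : 0 < A) (hB : 0 < B)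
    (h2 : κ * A ≤ ∫ t in s..b, f t ^ 2) (h4 : ∫ t in s..b, f t ^ 4 ≤ C * B * A ^ 2) :
    κ / (2 * √(2 * C / κ)) * √A / √B ≤ ∫ t in s..b, f t := by
  set T : ℝ := √(2 * C / κ) * √B * √A with hT
  have hTpos : 0 < T := by positivity
  have hT2 : T ^ 2 = 2 * C / κ * B * A := by
    rw [hT, mul_pow, mul_pow, Real.sq_sqrt (by positivity), Real.sq_sqrt hB.le, Real.sq_sqrt hA.le]
  have hpt : ∀ t, f t ^ 2 ≤ T * f t + f t ^ 4 / T ^ 2 := by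
    intro t
    have h0 := hf0 t
    rcases le_or_gt (f t) T with h | h
    · have : 0 ≤ f t ^ 4 / T ^ 2 := by positivity
      nlinarith
    · have h1 : f t ^ 2 ≤ f t ^ 4 / T ^ 2 := by
        rw [le_div_iff₀ (by positivity)]
        calc f t ^ 2 * T ^ 2 ≤ f t ^ 2 * f t ^ 2 := by gcongr
          _ = f t ^ 4 := by ring
      have : 0 ≤ T * f t := by positivity
      linarith
  have hmono : ∫ t in s..b, f t ^ 2 ≤ ∫ t in s..b, (T * f t + f t ^ 4 / T ^ 2) :=
    intervalIntegral.integral_mono hsb ((hf.pow 2).intervalIntegrable _ _)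
      (((hf.const_mul T).add ((hf.pow 4).div_const _)).intervalIntegrable _ _) hpt
  have i1 : IntervalIntegrable (fun t => T * f t) volume s b :=
    (hf.const_mul T).intervalIntegrable _ _
  have i2 : IntervalIntegrable (fun t => f t ^ 4 / T ^ 2) volume s b :=
    ((hf.pow 4).div_const _).intervalIntegrable _ _
  rw [intervalIntegral.integral_add i1 i2, intervalIntegral.integral_const_mul,
    intervalIntegral.integral_div] at hmono
  have h5 : (∫ t in s..b, f t ^ 4) / T ^ 2 ≤ κ * A / 2 := by
    rw [div_le_iff₀ (by positivity), hT2]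
    refine h4.trans_eq ?_
    field_simp
  have h6 : κ * A / 2 ≤ T * ∫ t in s..b, f t := by linarith
  have h7 : T * (κ / (2 * √(2 * C / κ)) * √A / √B) = κ * A / 2 := by
    have hA2 : √A * √A = A := Real.mul_self_sqrt hA.le
    rw [hT]
    have hu : 0 < √(2 * C / κ) := by positivity
    have hv : 0 < √B := by positivity
    generalize √(2 * C / κ) = u at *
    generalize √B = v at *
    field_simp
    linear_combination hA2
  rw [← h7] at h6
  exact le_of_mul_le_mul_left h6 hTpos

/-- For a smooth curve with nowhere-zero curvature, the restriction `L¹` norm satisfies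
`∫_C |F| ≫ ‖F‖₂ / √(B_lam)`. -/
theorem restriction_L1_lower_bound_via_B
    (L Kmin Kmax : ℝ) (γ : ℝ → ℝ × ℝ)
    (hL : 0 < L) (hKmin : 0 < Kmin)
    (hsmooth : ContDiff ℝ (⊤ : ℕ∞) γ)
    (hunit : ∀ t ∈ Set.Icc (0:ℝ) L, e2 (deriv γ t) = 1)
    (hcurv : ∀ t ∈ Set.Icc (0:ℝ) L,
      Kmin ≤ e2 (deriv (deriv γ) t) ∧ e2 (deriv (deriv γ) t) ≤ Kmax) :
    ∃ c > (0:ℝ), ∃ lam0 > (0:ℝ), ∀ lam : ℝ, lam0 ≤ lam →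
      ∀ a : ℤ × ℤ → ℂ,
        (∀ μ : ℤ × ℤ, a (-μ) = starRingEnd ℂ (a μ)) →
        (∃ μ ∈ Elat lam, a μ ≠ 0) →
        c * l2T (efn lam a) / Real.sqrt (Bmax lam)
          ≤ ∫ t in (0:ℝ)..L, ‖efn lam a (γ t)‖ := by
  obtain ⟨s, b, C, δ, hs, hsb, hb, hC, hδ, hdecay⟩ :=
    exists_subarc_curveHat_bounds hL hKmin hsmooth hunit fun t ht => (hcurv t ht).1
  obtain ⟨C₁, hC₁, hcard⟩ := exists_card_Elat_sq_le
  have hcont : Continuous γ := hsmooth.continuous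
  set K : ℝ := C + (b - s) with hK
  have hKpos : 0 < K := by linarith
  have hw0 : ∀ ξ, 0 ≤ ‖curveHat γ s b ξ‖ := fun ξ => norm_nonneg _
  have hwK : ∀ ξ, ‖curveHat γ s b ξ‖ ≤ K := fun ξ =>
    (norm_curveHat_le_length γ hsb.le ξ).trans (by linarith)
  have hwd : ∀ ξ, ‖curveHat γ s b ξ‖ * √‖latC ξ‖ ≤ K := by
    intro ξ
    by_cases hξ : ξ = 0
    · have : ‖latC ξ‖ = 0 := by simp [hξ, norm_latC]
      rw [this, Real.sqrt_zero, mul_zero]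
      exact hKpos.le
    · have h1 := one_le_norm_latC hξ
      have h2 := (hdecay ξ hξ).1
      rw [le_div_iff₀ (Real.sqrt_pos.mpr (by linarith))] at h2
      linarith
  set m₀ : ℝ := max 66 ((2 * (K * √C₁) / δ) ^ 2) with hm₀
  set C₄ : ℝ := 50796 * K + K * C₁ with hC₄
  refine ⟨δ / 2 / (2 * √(2 * C₄ / (δ / 2))) / (2 * π), by positivity, m₀ ^ 8, by positivity, ?_⟩
  rintro lam hlam a ha ⟨μ, hμ, haμ⟩
  obtain ⟨m, hm, rfl⟩ : ∃ m : ℝ, m₀ ≤ m ∧ lam = m ^ 8 := by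
    have hlam0 : 0 ≤ lam := le_trans (by positivity) hlam
    have hpow : (lam ^ (((8 : ℕ) : ℝ)⁻¹)) ^ 8 = lam := Real.rpow_inv_natCast_pow hlam0 (by norm_num)
    refine ⟨lam ^ (((8 : ℕ) : ℝ)⁻¹), ?_, hpow.symm⟩
    refine le_of_pow_le_pow_left₀ (n := 8) (by norm_num) (by positivity) ?_
    rwa [hpow]
  have hm66 : 66 ≤ m := (le_max_left _ _).trans hm
  have hm0 : 0 < m := by linarith
  have h8 : 0 ≤ m ^ 8 := by positivity
  have hcm := hcard m (by linarith)
  set A := ∑ p ∈ Elat (m ^ 8), ‖a p‖ ^ 2 with hA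
  have hApos : 0 < A := Finset.sum_pos' (fun p _ => by positivity)
    ⟨μ, hμ, by have := norm_pos_iff.mpr haμ; positivity⟩
  have hB : (1 : ℝ) ≤ Bmax (m ^ 8) := by
    have h := card_le_Bmax h8 (S := {μ}) (Finset.singleton_subset_iff.mpr hμ) (by
      intro p hp q hq
      rw [Finset.mem_singleton.mp hp, Finset.mem_singleton.mp hq, sub_self, norm_zero]
      positivity)
    rw [Finset.card_singleton] at h
    exact_mod_cast h
  have hsmall : K * √C₁ / √m ≤ δ / 2 := by
    have h1 : 2 * (K * √C₁) / δ ≤ √m := Real.le_sqrt_of_sq_le ((le_max_right _ _).trans hm)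
    rw [div_le_iff₀ hδ] at h1
    rw [div_le_iff₀ (Real.sqrt_pos.mpr hm0)]
    linarith
  have hL2 : δ / 2 * A ≤ ∫ t in s..b, ‖efn (m ^ 8) a (γ t)‖ ^ 2 := by
    have h1 := integral_norm_efn_sq_curve_ge hcont hsb.le (m ^ 8) a
    have h2 := sum_offDiag_le (by linarith) hw0 hwK hwd (fun ξ hξ => (hdecay ξ hξ).2) hcm
      (α := fun p => ‖a p‖) (fun p => norm_nonneg _)
    have h3 := mul_le_mul_of_nonneg_right hsmall hApos.le
    linarith
  have hL4 : ∫ t in s..b, ‖efn (m ^ 8) a (γ t)‖ ^ 4 ≤ C₄ * Bmax (m ^ 8) * A ^ 2 := by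
    have h1 := integral_norm_efn_pow_four_curve_le hcont hsb.le h8 ha
    have h2 := sum_quadruple_le hm66 hw0 hwK hwd hcm (α := fun p => ‖a p‖) (fun p => norm_nonneg _)
    refine (h1.trans h2).trans ?_
    gcongr
    have : K * C₁ * 1 ≤ K * C₁ * Bmax (m ^ 8) := by gcongr
    rw [hC₄]
    linarith
  have hFc : Continuous fun t => ‖efn (m ^ 8) a (γ t)‖ :=
    ((continuous_efn (m ^ 8) a).comp hcont).norm
  have hmain := integral_ge_of_sq_ge_of_pow_four_le hFc (fun t => norm_nonneg _) hsb.le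
    (half_pos hδ) (by positivity) hApos (by linarith) hL2 hL4
  rw [l2T_efn]
  refine le_trans (le_of_eq ?_) (hmain.trans ?_)
  · rw [← hA]
    field_simp
  · exact intervalIntegral.integral_mono_interval hs hsb.le hb
      (Filter.Eventually.of_forall fun t => norm_nonneg _) (hFc.intervalIntegrable _ _)
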